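/- arXiv:2002.07444 — 12 statements merged into one kernel-verified Lean document; each statement's English description precedes it below -/
import Mathlib

section
/- There exists a constant c > 0 such that for every n ≥ 1, MAJ_{2n+1} ∈ Thr(2, 2n+1, ⌈c · log₂(n+1)⌉); that is, the majority function on 2n+1 bits is computable by a formula of depth O(log n) consisting only of MAJ₃ gates and variables. (This is the existence part of the paper's Theorem 1; the paper additionally shows the formula is polynomial-time computable.) -/
/-- Number of ones of a Boolean vector. -/
def numOnes {N : ℕ} (x : Fin N → Bool) : ℕ :=
  (Finset.univ.filter fun i => x i = true).card

/-- THR^b_a : true iff the input has at least `a` ones. -/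
def THR {b : ℕ} (a : ℕ) (x : Fin b → Bool) : Bool :=
  decide (a ≤ numOnes x)

/-- The gate THR^{k+1}_2 : true iff at least 2 of the k+1 input bits are true. -/
def THRgate (k : ℕ) (v : Fin (k + 1) → Bool) : Bool :=
  decide (2 ≤ numOnes v)

/-- `Thr k n d` : Boolean functions on n variables computable by depth-d
formulas consisting only of THR^{k+1}_2 gates and variables. -/
def Thr (k n : ℕ) : ℕ → Set ((Fin n → Bool) → Bool)
  | 0 => { f | ∃ i : Fin n, f = fun x => x i }
  | d + 1 => Thr k n d ∪
      { f | ∃ g : Fin (k + 1) → ((Fin n → Bool) → Bool),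
          (∀ j, g j ∈ Thr k n d) ∧ f = fun x => THRgate k (fun j => g j x) }

/-- Amplification invariant: some nonempty finite family of depth-`d` formulas errs, on
each input, on at most a fraction `q` of its members. -/
def Approx (m : ℕ) (M : (Fin m → Bool) → Bool) (d : ℕ) (q : ℝ) : Prop :=
  ∃ (ι : Type) (_ : Fintype ι) (F : ι → (Fin m → Bool) → Bool),
    (∀ i, F i ∈ Thr 2 m d) ∧ 0 < Fintype.card ι ∧
    ∀ x, ∑ i, (if F i x = M x then (0 : ℝ) else 1) ≤ q * Fintype.card ι

lemma gate_eq (a b c : Bool) : THRgate 2 ![a, b, c] = (a && b || b && c || a && c) := by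
  revert a b c; decide

lemma thr_mono {k n d e : ℕ} (h : d ≤ e) : Thr k n d ⊆ Thr k n e := by
  induction h with
  | refl => exact subset_rfl
  | step _ ih => exact fun f hf => Or.inl (ih hf)

lemma approx_mono {m M d q q'} (h : Approx m M d q) (hq : q ≤ q') : Approx m M d q' := by
  obtain ⟨ι, _, F, h1, h2, h3⟩ := h
  exact ⟨ι, _, F, h1, h2, fun x => (h3 x).trans (by gcongr)⟩

lemma amp_mono {s q : ℝ} (h0 : 0 ≤ s) (h1 : s ≤ q) (h2 : q ≤ 1) :
    3 * s ^ 2 - 2 * s ^ 3 ≤ 3 * q ^ 2 - 2 * q ^ 3 := by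
  have h : 3 * q ^ 2 - 2 * q ^ 3 - (3 * s ^ 2 - 2 * s ^ 3)
      = (q - s) * (q * (1 - q) * 2 + q * (1 - s) + s * (1 - s) * 2 + s * (1 - q)) := by ring
  have : 0 ≤ (q - s) * (q * (1 - q) * 2 + q * (1 - s) + s * (1 - s) * 2 + s * (1 - q)) := by
    have a1 : 0 ≤ q - s := by linarith
    have a2 : 0 ≤ 1 - q := by linarith
    have a3 : 0 ≤ 1 - s := by linarith
    have a4 : 0 ≤ q := by linarith
    positivity
  linarith

lemma approx_step {m M d q} (h : Approx m M d q) (hq : q ≤ 1) :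
    Approx m M (d + 1) (3 * q ^ 2 - 2 * q ^ 3) := by
  obtain ⟨ι, _, F, h1, h2, h3⟩ := h
  refine ⟨ι × ι × ι, inferInstance,
    fun t x => THRgate 2 ![F t.1 x, F t.2.1 x, F t.2.2 x], ?_, ?_, ?_⟩
  · intro t
    refine Or.inr ⟨![F t.1, F t.2.1, F t.2.2], ?_, ?_⟩
    · intro j
      fin_cases j <;> simp [h1]
    · funext x
      congr 1
  · simp only [Fintype.card_prod]; positivity
  · intro x
    set u : ι → ℝ := fun i => if F i x = M x then (0 : ℝ) else 1 with hu
    have key : ∀ t : ι × ι × ι,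
        (if THRgate 2 ![F t.1 x, F t.2.1 x, F t.2.2 x] = M x then (0 : ℝ) else 1)
        = u t.1 * u t.2.1 + u t.2.1 * u t.2.2 + u t.1 * u t.2.2
          - 2 * (u t.1 * u t.2.1 * u t.2.2) := by
      intro t
      rw [gate_eq]
      simp only [hu]
      cases F t.1 x <;> cases F t.2.1 x <;> cases F t.2.2 x <;> cases M x <;> norm_num
    set S : ℝ := ∑ i, u i with hS
    set N : ℝ := (Fintype.card ι : ℝ) with hN
    have hNpos : 0 < N := by rw [hN]; exact_mod_cast h2
    have hsum : ∑ t : ι × ι × ι,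
        (if THRgate 2 ![F t.1 x, F t.2.1 x, F t.2.2 x] = M x then (0 : ℝ) else 1)
        = 3 * S ^ 2 * N - 2 * S ^ 3 := by
      rw [Finset.sum_congr rfl (fun t _ => key t)]
      simp only [Fintype.sum_prod_type, Finset.sum_add_distrib, Finset.sum_sub_distrib,
        ← Finset.mul_sum, ← Finset.sum_mul, Finset.sum_const, Finset.card_univ, nsmul_eq_mul,
        ← hS, ← hN]
      ring
    rw [hsum]
    have hS0 : 0 ≤ S := Finset.sum_nonneg fun i _ => by simp only [hu]; split_ifs <;> norm_num
    have hSq : S ≤ q * N := h3 x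
    obtain ⟨s, hs⟩ : ∃ s, S = s * N := ⟨S / N, by field_simp⟩
    rw [hs] at hS0 hSq ⊢
    have hs0 : 0 ≤ s := nonneg_of_mul_nonneg_left hS0 hNpos
    have hsq : s ≤ q := le_of_mul_le_mul_right hSq hNpos
    have := amp_mono hs0 hsq hq
    simp only [Fintype.card_prod, Nat.cast_mul, ← hN]
    have h5 : 0 ≤ N ^ 3 := by positivity
    nlinarith [mul_le_mul_of_nonneg_right this h5]

lemma approx_final {m M d q} (h : Approx m M d q) (hq : q * 2 ^ m < 1) : M ∈ Thr 2 m d := by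
  obtain ⟨ι, _, F, h1, h2, h3⟩ := h
  by_contra hM
  have hbad : ∀ i, (1 : ℝ) ≤ ∑ x, (if F i x = M x then (0 : ℝ) else 1) := by
    intro i
    have : ∃ x, F i x ≠ M x := by
      by_contra! hc
      exact hM ((funext hc : F i = M) ▸ h1 i)
    obtain ⟨x, hx⟩ := this
    have := Finset.single_le_sum (f := fun x => if F i x = M x then (0 : ℝ) else 1)
      (fun x _ => by split_ifs <;> norm_num) (Finset.mem_univ x)
    simpa [hx] using this
  have hN : (0 : ℝ) < Fintype.card ι := by exact_mod_cast h2
  have a := Finset.sum_le_sum (fun i (_ : i ∈ Finset.univ) => hbad i)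
  rw [Finset.sum_comm] at a
  have b := a.trans (Finset.sum_le_sum (fun x _ => h3 x))
  simp at b
  nlinarith

lemma approx_zero (n : ℕ) :
    Approx (2 * n + 1) (THR (n + 1)) 0 (1 / 2 - 1 / (4 * n + 2)) := by
  refine ⟨Fin (2 * n + 1), inferInstance, fun i x => x i, fun i => ⟨i, rfl⟩, by simp, ?_⟩
  intro x
  have hr : (1 / 2 - 1 / (4 * n + 2) : ℝ) * (Fintype.card (Fin (2 * n + 1)) : ℕ) = n := by
    simp only [Fintype.card_fin]
    push_cast
    have : (4 * n + 2 : ℝ) ≠ 0 := by positivity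
    field_simp
    ring
  rw [hr]
  have hc := Finset.card_filter_add_card_filter_not (s := (Finset.univ : Finset (Fin (2 * n + 1))))
    (fun i => x i = true)
  have hcount : ∑ i, (if x i = THR (n + 1) x then (0 : ℝ) else 1)
      = ((Finset.univ.filter fun i => ¬ x i = THR (n + 1) x).card : ℝ) := by
    rw [Finset.card_filter]
    push_cast
    exact Finset.sum_congr rfl fun i _ => by split_ifs <;> simp_all
  rw [hcount]
  norm_cast
  simp only [Finset.card_univ, Fintype.card_fin] at hc
  by_cases h : n + 1 ≤ numOnes x
  · have : THR (n + 1) x = true := by simp [THR, h]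
    rw [this]
    unfold numOnes at h
    omega
  · have : THR (n + 1) x = false := by simp [THR, h]
    rw [this]
    unfold numOnes at h
    simp only [Bool.not_eq_false]
    omega

lemma step_gap {m M d} {e : ℝ} (he0 : 0 ≤ e) (he : e ≤ 1 / 4)
    (h : Approx m M d (1 / 2 - e)) : Approx m M (d + 1) (1 / 2 - min (1 / 4) (11 / 8 * e)) := by
  refine approx_mono (approx_step h (by linarith)) ?_
  have h1 : e ^ 2 ≤ 1 / 16 := by nlinarith
  have h2 : e ^ 3 ≤ 1 / 16 * e := by nlinarith
  have := min_le_right (1 / 4) (11 / 8 * e)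
  nlinarith

lemma phase_one {m M} {e : ℝ} (he0 : 0 ≤ e) (he : e ≤ 1 / 4)
    (h : Approx m M 0 (1 / 2 - e)) (d : ℕ) :
    Approx m M d (1 / 2 - min (1 / 4) ((11 / 8) ^ d * e)) := by
  induction d with
  | zero => rwa [pow_zero, one_mul, min_eq_right he]
  | succ d ih =>
    have h0 : 0 ≤ (11 / 8 : ℝ) ^ d * e := by positivity
    have := step_gap (le_min (by norm_num) h0) (min_le_left _ _) ih
    refine approx_mono this ?_
    rw [pow_succ]
    rcases le_total (1 / 4) ((11 / 8 : ℝ) ^ d * e) with h | h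
    · rw [min_eq_left h, min_eq_left (by norm_num)]
      linarith [min_le_left (1 / 4) ((11 / 8 : ℝ) ^ d * (11 / 8) * e)]
    · rw [min_eq_right h]
      exact le_of_eq (by ring_nf)

lemma phase_two {m M d} (h : Approx m M d (1 / 4)) (j : ℕ) :
    Approx m M (d + j) (1 / 3 * (3 / 4) ^ (2 ^ j)) := by
  induction j with
  | zero => exact approx_mono h (by norm_num)
  | succ j ih =>
    have hp : (0 : ℝ) ≤ (3 / 4) ^ (2 ^ j) := by positivity
    have hp1 : ((3 / 4) ^ (2 ^ j) : ℝ) ≤ 1 := pow_le_one₀ (by norm_num) (by norm_num)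
    refine approx_mono (approx_step ih (by linarith)) ?_
    rw [pow_succ 2 j, pow_mul]
    have : 0 ≤ ((3 / 4) ^ (2 ^ j) : ℝ) ^ 3 := by positivity
    nlinarith

lemma maj_depth (n k : ℕ) (hn : 1 ≤ n) (hk : n + 1 ≤ 2 ^ k) :
    THR (b := 2 * n + 1) (n + 1) ∈ Thr 2 (2 * n + 1) (3 * k + (k + 3)) := by
  have hn' : (1 : ℝ) ≤ n := by exact_mod_cast hn
  have hk' : (n + 1 : ℝ) ≤ 2 ^ k := by exact_mod_cast hk
  have h1 := phase_one (e := 1 / (4 * n + 2)) (by positivity)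
    (by rw [div_le_div_iff₀ (by positivity) (by norm_num)]; linarith) (approx_zero n) (3 * k)
  have h2 : Approx (2 * n + 1) (THR (n + 1)) (3 * k) (1 / 4) := by
    refine approx_mono h1 ?_
    have : (1 / 4 : ℝ) ≤ (11 / 8) ^ (3 * k) * (1 / (4 * n + 2)) := by
      have h3 : (2 : ℝ) ^ k ≤ (11 / 8) ^ (3 * k) := by
        rw [pow_mul]
        exact pow_le_pow_left₀ (by norm_num) (by norm_num) k
      rw [mul_one_div, div_le_div_iff₀ (by norm_num) (by positivity)]
      linarith
    rw [min_eq_left this]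
    norm_num
  refine approx_final (phase_two h2 (k + 3)) ?_
  have h4 : ((3 / 4) ^ (2 ^ (k + 3)) : ℝ) ≤ (1 / 2) ^ (2 * n + 1) := by
    calc ((3 / 4) ^ (2 ^ (k + 3)) : ℝ) ≤ (3 / 4) ^ (4 * (2 * n + 1)) := by
          apply pow_le_pow_of_le_one (by norm_num) (by norm_num)
          rw [pow_add]; omega
      _ = ((3 / 4) ^ 4) ^ (2 * n + 1) := by rw [pow_mul]
      _ ≤ _ := pow_le_pow_left₀ (by norm_num) (by norm_num) _
  have h5 : ((1 / 2) ^ (2 * n + 1) : ℝ) * 2 ^ (2 * n + 1) = 1 := by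
    rw [← mul_pow]; norm_num
  have h6 : (0 : ℝ) < 2 ^ (2 * n + 1) := by positivity
  nlinarith [mul_le_mul_of_nonneg_right h4 h6.le]

/-- MAJ_{2n+1} is computable by an O(log n)-depth formula
consisting only of MAJ₃ gates and variables. -/
theorem maj_in_maj3_logdepth :
    ∃ c : ℝ, 0 < c ∧ ∀ n : ℕ, 1 ≤ n →
      THR (b := 2 * n + 1) (n + 1) ∈
        Thr 2 (2 * n + 1) ⌈c * Real.logb 2 (n + 1)⌉₊ := by
  refine ⟨11, by norm_num, fun n hn => ?_⟩
  have hn' : (1 : ℝ) ≤ n := by exact_mod_cast hn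
  have hL : 1 ≤ Real.logb 2 (n + 1) := by
    rw [Real.le_logb_iff_rpow_le (by norm_num) (by positivity)]
    norm_num
    linarith
  have hk : n + 1 ≤ 2 ^ ⌈Real.logb 2 (n + 1)⌉₊ := by
    have : ((n + 1 : ℕ) : ℝ) ≤ ((2 ^ ⌈Real.logb 2 (n + 1)⌉₊ : ℕ) : ℝ) := by
      push_cast
      rw [← Real.rpow_natCast, ← Real.logb_le_iff_le_rpow (by norm_num) (by positivity)]
      exact Nat.le_ceil _
    exact_mod_cast this
  refine thr_mono ?_ (maj_depth n _ hn hk)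
  have h1 := Nat.ceil_lt_add_one (show 0 ≤ Real.logb 2 (n + 1) by linarith)
  have h2 := Nat.le_ceil (11 * Real.logb 2 (n + 1))
  have : ((3 * ⌈Real.logb 2 (n + 1)⌉₊ + (⌈Real.logb 2 (n + 1)⌉₊ + 3) : ℕ) : ℝ)
      ≤ (⌈11 * Real.logb 2 (n + 1)⌉₊ : ℕ) := by
    push_cast
    linarith
  exact_mod_cast this
end

section
/- There exists a constant c > 0 such that for all n ≥ 1 and s ≥ 1: if there is a monotone formula of size s computing MAJ_{2n+1}, then there is a MAJ₃-formula of size at most c · s · n^{log₂ 3} computing MAJ_{2n+1}. -/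
/-- Majority of 3 bits. -/
def maj3 (a b c : Bool) : Bool := (a && b) || (a && c) || (b && c)

/-- Monotone formulas: ∧/∨ gates and variables. -/
inductive MonFormula (N : ℕ) : Type
  | var (i : Fin N)
  | and (F G : MonFormula N)
  | or (F G : MonFormula N)

def MonFormula.eval {N : ℕ} : MonFormula N → (Fin N → Bool) → Bool
  | .var i, x => x i
  | .and F G, x => F.eval x && G.eval x
  | .or F G, x => F.eval x || G.eval x

/-- Size of a monotone formula = number of leaves. -/
def MonFormula.size {N : ℕ} : MonFormula N → ℕ
  | .var _ => 1
  | .and F G => F.size + G.size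
  | .or F G => F.size + G.size

/-- MAJ₃-formulas: MAJ₃ gates and variables. -/
inductive Maj3Formula (N : ℕ) : Type
  | var (i : Fin N)
  | maj (F G H : Maj3Formula N)

def Maj3Formula.eval {N : ℕ} : Maj3Formula N → (Fin N → Bool) → Bool
  | .var i, x => x i
  | .maj F G H, x => maj3 (F.eval x) (G.eval x) (H.eval x)

/-- Size of a MAJ₃-formula = number of leaves. -/
def Maj3Formula.size {N : ℕ} : Maj3Formula N → ℕ
  | .var _ => 1
  | .maj F G H => F.size + G.size + H.size

/-- Replace `and` by `maj` with the variable `i`, `or` by `maj` with the variable `j`. -/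
def convF {N : ℕ} (i j : Fin N) : MonFormula N → Maj3Formula N
  | .var k => .var k
  | .and F G => .maj (convF i j F) (convF i j G) (.var i)
  | .or F G => .maj (convF i j F) (convF i j G) (.var j)

lemma convF_size {N : ℕ} (i j : Fin N) (F : MonFormula N) :
    (convF i j F).size + 1 = 2 * F.size := by
  induction F with
  | var k => simp [convF, Maj3Formula.size, MonFormula.size]
  | and F G hF hG => simp only [convF, Maj3Formula.size, MonFormula.size]; omega
  | or F G hF hG => simp only [convF, Maj3Formula.size, MonFormula.size]; omega

lemma convF_eval_left {N : ℕ} (i j : Fin N) (F : MonFormula N) (x : Fin N → Bool) (b : Bool)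
    (hj : (if b then x j else x i) = b) (h : F.eval x = b) : (convF i j F).eval x = b := by
  induction F with
  | var k => simpa [convF, Maj3Formula.eval, MonFormula.eval] using h
  | and F G hF hG =>
    simp only [convF, Maj3Formula.eval, MonFormula.eval, maj3] at *
    cases b <;> cases h1 : F.eval x <;> cases h2 : G.eval x <;> simp_all
  | or F G hF hG =>
    simp only [convF, Maj3Formula.eval, MonFormula.eval, maj3] at *
    cases b <;> cases h1 : F.eval x <;> cases h2 : G.eval x <;> simp_all

lemma convF_eval_right {N : ℕ} (i j : Fin N) (F : MonFormula N) (x : Fin N → Bool) (b : Bool)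
    (hj : (if b then x i else x j) = b) (h : F.eval (fun k => !(x k)) = !b) :
    (convF i j F).eval x = b := by
  induction F with
  | var k => simpa [convF, Maj3Formula.eval, MonFormula.eval] using h
  | and F G hF hG =>
    simp only [convF, Maj3Formula.eval, MonFormula.eval, maj3] at *
    cases b <;> cases h1 : F.eval (fun k => !(x k)) <;>
      cases h2 : G.eval (fun k => !(x k)) <;> simp_all
  | or F G hF hG =>
    simp only [convF, Maj3Formula.eval, MonFormula.eval, maj3] at *
    cases b <;> cases h1 : F.eval (fun k => !(x k)) <;>
      cases h2 : G.eval (fun k => !(x k)) <;> simp_all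

lemma numOnes_not {N : ℕ} (x : Fin N → Bool) :
    numOnes x + numOnes (fun k => !(x k)) = N := by
  have h := Finset.card_filter_add_card_filter_not
    (s := (Finset.univ : Finset (Fin N))) (fun i => x i = true)
  simpa [numOnes] using h

lemma THR_not (n : ℕ) (x : Fin (2 * n + 1) → Bool) :
    THR (b := 2 * n + 1) (n + 1) (fun k => !(x k)) = !THR (b := 2 * n + 1) (n + 1) x := by
  have h := numOnes_not x
  unfold THR
  rw [← decide_not, decide_eq_decide]
  omega

lemma minority_card (n : ℕ) (x : Fin (2 * n + 1) → Bool) :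
    (Finset.univ.filter fun i => x i ≠ THR (b := 2 * n + 1) (n + 1) x).card ≤ n := by
  have h := numOnes_not x
  cases hb : THR (b := 2 * n + 1) (n + 1) x
  · have : ¬ (n + 1 ≤ numOnes x) := by simpa [THR] using hb
    simp only [numOnes] at *
    simp at *
    omega
  · have : n + 1 ≤ numOnes x := by simpa [THR] using hb
    simp only [numOnes] at *
    simp at *
    omega

lemma convF_good (n : ℕ) (F : MonFormula (2 * n + 1))
    (hF : ∀ x, F.eval x = THR (b := 2 * n + 1) (n + 1) x) (i j : Fin (2 * n + 1))
    (x : Fin (2 * n + 1) → Bool)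
    (h : x i = THR (b := 2 * n + 1) (n + 1) x ∨ x j = THR (b := 2 * n + 1) (n + 1) x) :
    (convF i j F).eval x = THR (b := 2 * n + 1) (n + 1) x := by
  have h1 := hF x
  have h2 := (hF (fun k => !(x k))).trans (THR_not n x)
  generalize THR (b := 2 * n + 1) (n + 1) x = b at *
  have L := convF_eval_left i j F x b
  have R := convF_eval_right i j F x b
  cases b <;> rcases h with h | h <;> simp_all

/-- Amplified random formulas, with a bound on the failure probability. -/
lemma amplify (n : ℕ) (F : MonFormula (2 * n + 1))
    (hF : ∀ x, F.eval x = THR (b := 2 * n + 1) (n + 1) x) (d : ℕ) :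
    ∃ (T : Type) (_ : Fintype T) (_ : Nonempty T) (ev : T → Maj3Formula (2 * n + 1)),
      (∀ t, (ev t).size ≤ 3 ^ d * (2 * F.size)) ∧
      ∀ x, 3 * ((Finset.univ.filter fun t =>
        (ev t).eval x ≠ THR (b := 2 * n + 1) (n + 1) x).card : ℝ)
          ≤ (3 / 4 : ℝ) ^ (2 ^ d) * (Fintype.card T : ℝ) := by
  induction d with
  | zero =>
    refine ⟨Fin (2 * n + 1) × Fin (2 * n + 1), inferInstance, inferInstance,
      fun t => convF t.1 t.2 F, ?_, ?_⟩
    · intro t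
      have := convF_size t.1 t.2 F
      simp only [pow_zero, one_mul]
      omega
    · intro x
      have hm := minority_card n x
      set B := Finset.univ.filter fun i => x i ≠ THR (b := 2 * n + 1) (n + 1) x with hB
      have hsub : (Finset.univ.filter fun t : Fin (2 * n + 1) × Fin (2 * n + 1) =>
          (convF t.1 t.2 F).eval x ≠ THR (b := 2 * n + 1) (n + 1) x) ⊆ B ×ˢ B := by
        intro t ht
        have ht' := (Finset.mem_filter.1 ht).2
        rw [Finset.mem_product, hB, Finset.mem_filter, Finset.mem_filter]
        refine ⟨⟨Finset.mem_univ _, fun h => ht' ?_⟩, ⟨Finset.mem_univ _, fun h => ht' ?_⟩⟩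
        · exact convF_good n F hF _ _ x (Or.inl h)
        · exact convF_good n F hF _ _ x (Or.inr h)
      have hc := Finset.card_le_card hsub
      rw [Finset.card_product] at hc
      have hc2 := hc.trans (Nat.mul_le_mul hm hm)
      have hc3 : ((Finset.univ.filter fun t : Fin (2 * n + 1) × Fin (2 * n + 1) =>
          (convF t.1 t.2 F).eval x ≠ THR (b := 2 * n + 1) (n + 1) x).card : ℝ) ≤ n * n := by
        exact_mod_cast hc2
      simp only [Fintype.card_prod, Fintype.card_fin, pow_zero, pow_one]
      push_cast
      have : (0 : ℝ) ≤ n := Nat.cast_nonneg n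
      nlinarith
  | succ d ih =>
    obtain ⟨T, hT, hne, ev, hs, hb⟩ := ih
    classical
    refine ⟨T × T × T, inferInstance, inferInstance,
      fun t => .maj (ev t.1) (ev t.2.1) (ev t.2.2), ?_, ?_⟩
    · intro t
      have h1 := hs t.1
      have h2 := hs t.2.1
      have h3 := hs t.2.2
      simp only [Maj3Formula.size, pow_succ]
      linarith
    · intro x
      have hbx := hb x
      set B := Finset.univ.filter fun t => (ev t).eval x ≠ THR (b := 2 * n + 1) (n + 1) x with hB
      have hsub : (Finset.univ.filter fun t : T × T × T =>
          (Maj3Formula.maj (ev t.1) (ev t.2.1) (ev t.2.2)).eval x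
            ≠ THR (b := 2 * n + 1) (n + 1) x) ⊆
          (B ×ˢ B ×ˢ Finset.univ) ∪ (B ×ˢ Finset.univ ×ˢ B) ∪ (Finset.univ ×ˢ B ×ˢ B) := by
        intro t ht
        have ht' := (Finset.mem_filter.1 ht).2
        simp only [Finset.mem_union, Finset.mem_product, hB, Finset.mem_filter, Finset.mem_univ,
          true_and, and_true]
        simp only [Maj3Formula.eval, maj3] at ht'
        generalize THR (b := 2 * n + 1) (n + 1) x = b at *
        generalize (ev t.1).eval x = p at *
        generalize (ev t.2.1).eval x = q at *
        generalize (ev t.2.2).eval x = r at *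
        revert ht'
        cases b <;> cases p <;> cases q <;> cases r <;> simp
      have hc := ((Finset.card_le_card hsub).trans (Finset.card_union_le _ _)).trans
        (Nat.add_le_add_right (Finset.card_union_le _ _) _)
      simp only [Finset.card_product, Finset.card_univ] at hc
      have hc3 : ((Finset.univ.filter fun t : T × T × T =>
          (Maj3Formula.maj (ev t.1) (ev t.2.1) (ev t.2.2)).eval x
            ≠ THR (b := 2 * n + 1) (n + 1) x).card : ℝ) ≤
          3 * ((B.card : ℝ) ^ 2 * Fintype.card T) := by
        refine (Nat.cast_le.2 hc).trans (le_of_eq ?_)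
        push_cast
        ring
      have hsq := mul_self_le_mul_self (by positivity) hbx
      have hTn : (0 : ℝ) ≤ Fintype.card T := Nat.cast_nonneg _
      have hfin := mul_le_mul_of_nonneg_right hsq hTn
      simp only [Fintype.card_prod]
      push_cast
      calc _ ≤ 3 * (3 * ((B.card : ℝ) ^ 2 * Fintype.card T)) := by linarith
        _ = 3 * (B.card : ℝ) * (3 * (B.card : ℝ)) * Fintype.card T := by ring
        _ ≤ _ := hfin
        _ = _ := by rw [pow_succ 2 d, pow_mul]; ring

lemma exists_formula (n : ℕ) (F : MonFormula (2 * n + 1))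
    (hF : ∀ x, F.eval x = THR (b := 2 * n + 1) (n + 1) x) (d : ℕ)
    (hd : 3 * (2 * n + 1) ≤ 2 ^ d) :
    ∃ G : Maj3Formula (2 * n + 1), G.size ≤ 3 ^ d * (2 * F.size) ∧
      ∀ x, G.eval x = THR (b := 2 * n + 1) (n + 1) x := by
  classical
  obtain ⟨T, hT, hne, ev, hs, hb⟩ := amplify n F hF d
  by_contra hcon
  push Not at hcon
  have hall : ∀ t, ∃ x, (ev t).eval x ≠ THR (b := 2 * n + 1) (n + 1) x :=
    fun t => hcon (ev t) (hs t)
  have hsub : (Finset.univ : Finset T) ⊆ Finset.univ.biUnion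
      (fun x : Fin (2 * n + 1) → Bool => Finset.univ.filter fun t =>
        (ev t).eval x ≠ THR (b := 2 * n + 1) (n + 1) x) := by
    intro t _
    obtain ⟨x, hx⟩ := hall t
    exact Finset.mem_biUnion.2 ⟨x, Finset.mem_univ _, Finset.mem_filter.2 ⟨Finset.mem_univ _, hx⟩⟩
  have hc := (Finset.card_le_card hsub).trans Finset.card_biUnion_le
  rw [Finset.card_univ] at hc
  have hc' : (Fintype.card T : ℝ) ≤ ∑ x : Fin (2 * n + 1) → Bool,
      ((Finset.univ.filter fun t =>
        (ev t).eval x ≠ THR (b := 2 * n + 1) (n + 1) x).card : ℝ) := by exact_mod_cast hc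
  have hpos : (0 : ℝ) < Fintype.card T := by exact_mod_cast Fintype.card_pos
  have hsum : 3 * (Fintype.card T : ℝ) ≤
      (2 : ℝ) ^ (2 * n + 1) * ((3 / 4 : ℝ) ^ (2 ^ d) * (Fintype.card T : ℝ)) := by
    calc _ ≤ 3 * ∑ x : Fin (2 * n + 1) → Bool, ((Finset.univ.filter fun t =>
        (ev t).eval x ≠ THR (b := 2 * n + 1) (n + 1) x).card : ℝ) := by linarith
      _ ≤ ∑ x : Fin (2 * n + 1) → Bool, (3 / 4 : ℝ) ^ (2 ^ d) * (Fintype.card T : ℝ) := by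
        rw [Finset.mul_sum]
        exact Finset.sum_le_sum fun x _ => hb x
      _ = _ := by simp
  have hq : (2 : ℝ) ^ (2 * n + 1) * (3 / 4 : ℝ) ^ (2 ^ d) ≤ 1 := by
    calc (2 : ℝ) ^ (2 * n + 1) * (3 / 4 : ℝ) ^ (2 ^ d)
        ≤ (2 : ℝ) ^ (2 * n + 1) * (3 / 4 : ℝ) ^ (3 * (2 * n + 1)) := by
          gcongr ?_ * ?_
          exact pow_le_pow_of_le_one (by norm_num) (by norm_num) hd
      _ = (2 * (3 / 4 : ℝ) ^ 3) ^ (2 * n + 1) := by rw [pow_mul, ← mul_pow]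
      _ ≤ 1 := pow_le_one₀ (by norm_num) (by norm_num)
  nlinarith [mul_le_mul_of_nonneg_right hq hpos.le]

theorem mon_to_maj3_size :
    ∃ c : ℝ, 0 < c ∧ ∀ n s : ℕ, 1 ≤ n → 1 ≤ s →
      (∃ F : MonFormula (2 * n + 1), F.size = s ∧
        ∀ x, F.eval x = THR (b := 2 * n + 1) (n + 1) x) →
      ∃ G : Maj3Formula (2 * n + 1),
        (G.size : ℝ) ≤ c * s * (n : ℝ) ^ Real.logb 2 3 ∧
        ∀ x, G.eval x = THR (b := 2 * n + 1) (n + 1) x := by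
  refine ⟨486, by norm_num, ?_⟩
  rintro n s hn - ⟨F, rfl, hF⟩
  have hlt : n < 2 ^ (Nat.log 2 n + 1) := Nat.lt_pow_succ_log_self (by norm_num) n
  have hle : 2 ^ Nat.log 2 n ≤ n := Nat.pow_log_le_self 2 (by omega)
  generalize Nat.log 2 n = k at *
  obtain ⟨G, hG, hGe⟩ := exists_formula n F hF (k + 5) (by
    rw [pow_add] at *
    omega)
  refine ⟨G, ?_, hGe⟩
  have h3 : (3 : ℝ) ^ k ≤ (n : ℝ) ^ Real.logb 2 3 := by
    have e : (3 : ℝ) ^ k = ((2 : ℝ) ^ k) ^ Real.logb 2 3 := by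
      rw [← Real.rpow_natCast 2 k, ← Real.rpow_mul (by norm_num), mul_comm,
        Real.rpow_mul (by norm_num), Real.rpow_logb (by norm_num) (by norm_num) (by norm_num),
        Real.rpow_natCast]
    rw [e]
    apply Real.rpow_le_rpow (by positivity) (by exact_mod_cast hle)
    exact Real.logb_nonneg (by norm_num) (by norm_num)
  have hG' : (G.size : ℝ) ≤ 3 ^ (k + 5) * (2 * F.size) := by exact_mod_cast hG
  calc (G.size : ℝ) ≤ 3 ^ (k + 5) * (2 * F.size) := hG'
    _ = 486 * F.size * 3 ^ k := by ring
    _ ≤ _ := by gcongr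
end

section
/- For every k ≥ 2 there exists a constant c > 0 such that for every n ≥ 1, THR^{kn+1}_{n+1} ∈ Thr(k, k·n+1, ⌈c · (log₂(n+1))²⌉); that is, THR^{kn+1}_{n+1} is computable by a formula of depth O(log² n) consisting only of THR^{k+1}_2 gates and variables. (This is the depth assertion of the paper's Theorem 3 / Corollary 'weak version', dropping the explicitness and circuit-size claims.) -/
namespace ThrAux

theorem gate_false_of {k : ℕ} (v : Fin (k + 1) → Bool)
    (h : ∀ i j, v i = true → v j = true → i = j) : THRgate k v = false := by
  unfold THRgate numOnes
  rw [decide_eq_false_iff_not, not_le]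
  have : (Finset.univ.filter fun i => v i = true).card ≤ 1 := by
    rw [Finset.card_le_one]
    intro a ha b hb
    simp only [Finset.mem_filter, Finset.mem_univ, true_and] at ha hb
    exact h a b ha hb
  omega

theorem gate_true_of {k : ℕ} (v : Fin (k + 1) → Bool) (i j : Fin (k + 1)) (hij : i ≠ j)
    (hi : v i = true) (hj : v j = true) : THRgate k v = true := by
  unfold THRgate numOnes
  rw [decide_eq_true_iff]
  have : 1 < (Finset.univ.filter fun i => v i = true).card := by
    rw [Finset.one_lt_card]
    exact ⟨i, by simp [hi], j, by simp [hj], hij⟩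
  omega

theorem thr_mono {k n d d_p : ℕ} (h : d ≤ d_p) : Thr k n d ⊆ Thr k n d_p := by
  induction h with
  | refl => exact subset_rfl
  | step _ ih => exact ih.trans Set.subset_union_left

/-- Any `k` zeros of a formula share a zero coordinate. -/
theorem common_zero {k N : ℕ} (d : ℕ) : ∀ F ∈ Thr k N d, ∀ z : Fin k → Fin N → Bool,
    (∀ j, F (z j) = false) → ∃ i, ∀ j, z j i = false := by
  induction d with
  | zero =>
    rintro F ⟨i, rfl⟩ z hz
    exact ⟨i, hz⟩
  | succ d ih =>
    rintro F (hF | ⟨g, hg, rfl⟩) z hz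
    · exact ih F hF z hz
    · by_cases hc : ∃ c, ∀ j, g c (z j) = false
      · obtain ⟨c, hc⟩ := hc
        exact ih _ (hg c) z hc
      · exfalso
        push Not at hc
        choose q hq using hc
        obtain ⟨a, b, hab, he⟩ := Fintype.exists_ne_map_eq_of_card_lt q (by simp)
        have h1 := gate_true_of (fun j => g j (z (q a))) a b hab
          (by simpa using hq a) (by have := hq b; rw [← he] at this; simpa using this)
        have h2 := hz (q a)
        simp only at h2
        rw [h1] at h2
        cases h2

/-- Some depth-`d` formula vanishes on `Z`. -/
def Win (k N d : ℕ) (Z : Set (Fin N → Bool)) : Prop :=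
  ∃ F ∈ Thr k N d, ∀ z ∈ Z, F z = false

/-- One round: each point is dropped from at most one child. -/
theorem win_step {k N d : ℕ} (Z : Set (Fin N → Bool)) (W : Fin (k + 1) → Set (Fin N → Bool))
    (hW : ∀ j, Win k N d (W j)) (h : ∀ z ∈ Z, ∀ i j, z ∉ W i → z ∉ W j → i = j) :
    Win k N (d + 1) Z := by
  choose g hg hg0 using hW
  refine ⟨fun x => THRgate k (fun j => g j x), Or.inr ⟨g, hg, rfl⟩, ?_⟩
  intro z hz
  apply gate_false_of
  intro i j hi hj
  apply h z hz
  · intro hm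
    rw [hg0 i z hm] at hi
    cases hi
  · intro hm
    rw [hg0 j z hm] at hj
    cases hj

/-- disjoint parts of size `s` -/
theorem exists_parts {K : Type*} [DecidableEq K] (A : Finset K) (k s : ℕ)
    (h : (k + 1) * s ≤ A.card) :
    ∃ P : Fin (k + 1) → Finset K, (∀ j, P j ⊆ A) ∧ (∀ j, (P j).card = s) ∧
      ∀ a i j, a ∈ P i → a ∈ P j → i = j := by
  have hlt : ∀ (j : Fin (k + 1)) (i : Fin s), j.val * s + i.val < A.card := by
    intro j i
    have h1 : (j.val + 1) * s ≤ (k + 1) * s := Nat.mul_le_mul_right _ (by omega)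
    have := i.2
    nlinarith
  let e := A.equivFin
  let f : Fin (k + 1) → Fin s → K := fun j i => (e.symm ⟨j.val * s + i.val, hlt j i⟩ : K)
  have hf : ∀ j j_p i i_p, f j i = f j_p i_p → j.val * s + i.val = j_p.val * s + i_p.val := by
    intro j j_p i i_p hh
    have := e.symm.injective (Subtype.ext hh)
    simpa using this
  refine ⟨fun j => Finset.univ.image (f j), ?_, ?_, ?_⟩
  · intro j a ha
    simp only [Finset.mem_image, Finset.mem_univ, true_and] at ha
    obtain ⟨i, rfl⟩ := ha
    exact (e.symm _).2
  · intro j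
    rw [Finset.card_image_of_injective]
    · simp
    · intro i i_p hh
      have := hf _ _ _ _ hh
      exact Fin.ext (by omega)
  · intro a i j hi hj
    simp only [Finset.mem_image, Finset.mem_univ, true_and] at hi hj
    obtain ⟨u, rfl⟩ := hi
    obtain ⟨v, hv⟩ := hj
    have h1 := hf _ _ _ _ hv
    have hu := u.2
    have hv2 := v.2
    have hs : 0 < s := by omega
    have h2 : (v.val + j.val * s) / s = (u.val + i.val * s) / s := by
      rw [Nat.add_comm, h1, Nat.add_comm]
    rw [Nat.add_mul_div_right _ _ hs, Nat.div_eq_of_lt hv2,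
      Nat.add_mul_div_right _ _ hs, Nat.div_eq_of_lt hu] at h2
    exact Fin.ext (by omega)

/-- Reduce the number of possible types to `k`. -/
theorem win_reduce {k N d : ℕ} {K : Type*} [DecidableEq K] (Z : Set (Fin N → Bool))
    (τ : (Fin N → Bool) → K)
    (base : ∀ A : Finset K, A.card ≤ k → Win k N d {z | z ∈ Z ∧ τ z ∈ A}) (r : ℕ) :
    ∀ A : Finset K, (A.card : ℝ) * (1 - 1 / (2 * k + 2 : ℕ)) ^ r < k + 1 →
      Win k N (d + r) {z | z ∈ Z ∧ τ z ∈ A} := by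
  induction r with
  | zero =>
    intro A hA
    apply base
    simp only [pow_zero, mul_one] at hA
    have : A.card < k + 1 := by exact_mod_cast hA
    omega
  | succ r ih =>
    intro A hA
    by_cases hk : A.card ≤ k
    · obtain ⟨F, hF, h0⟩ := base A hk
      exact ⟨F, thr_mono (by omega) hF, h0⟩
    · obtain ⟨P, hPA, hPc, hPd⟩ := exists_parts A k (A.card / (k + 1)) (Nat.mul_div_le _ _)
      apply win_step _ (fun j => {z | z ∈ Z ∧ τ z ∈ A \ P j})
      · intro j
        apply ih
        rw [Finset.card_sdiff_of_subset (hPA j), hPc]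
        refine lt_of_le_of_lt ?_ hA
        rw [pow_succ, mul_comm (_ ^ r), ← mul_assoc]
        have hq : (0 : ℝ) ≤ 1 - 1 / (2 * k + 2 : ℕ) := by
          rw [sub_nonneg, div_le_one (by positivity)]
          push_cast
          have : (0 : ℝ) ≤ k := by positivity
          linarith
        apply mul_le_mul_of_nonneg_right _ (pow_nonneg hq r)
        set m := A.card
        set s := m / (k + 1) with hs
        have hs1 : 1 ≤ s := by
          rw [hs, Nat.le_div_iff_mul_le (by omega)]
          omega
        have hs2 : m < (k + 1) * (s + 1) := by
          rw [hs, mul_comm]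
          have := Nat.lt_div_mul_add (a := m) (b := k + 1) (by omega)
          linarith
        have hs3 : s ≤ m := Nat.div_le_self _ _
        have hs4 : m ≤ s * (2 * k + 2) := by nlinarith
        rw [Nat.cast_sub hs3]
        have hs5 : (m : ℝ) / (2 * k + 2 : ℕ) ≤ s := by
          rw [div_le_iff₀ (by positivity)]
          exact_mod_cast hs4
        rw [mul_sub, mul_one, mul_one_div]
        linarith
      · rintro z ⟨hz, hzA⟩ i j hi hj
        simp only [Set.mem_setOf_eq, Finset.mem_sdiff, not_and, not_not] at hi hj
        exact hPd _ i j (hi hz hzA) (hj hz hzA)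

theorem win_reduce_p {k N d e : ℕ} {K : Type*} [Fintype K] [DecidableEq K]
    (Z : Set (Fin N → Bool)) (τ : (Fin N → Bool) → K) (hK : Fintype.card K ≤ 2 ^ e) (hk : 1 ≤ k)
    (base : ∀ A : Finset K, A.card ≤ k → Win k N d {z | z ∈ Z ∧ τ z ∈ A}) :
    Win k N (d + (2 * k + 2) * e) Z := by
  have := win_reduce Z τ base ((2 * k + 2) * e) Finset.univ ?_
  · simpa using this
  · rw [pow_mul]
    have h1 : (1 - 1 / ((2 * k + 2 : ℕ) : ℝ)) ^ (2 * k + 2) ≤ 1 / 2 := by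
      refine (Real.one_sub_div_pow_le_exp_neg (n := 2 * k + 2) (t := 1) ?_).trans ?_
      · push_cast
        have : (0 : ℝ) ≤ k := by positivity
        linarith
      · have := Real.exp_neg_one_lt_d9
        linarith
    have hq : (0 : ℝ) ≤ 1 - 1 / (2 * k + 2 : ℕ) := by
      rw [sub_nonneg, div_le_one (by positivity)]
      push_cast
      have : (0 : ℝ) ≤ k := by positivity
      linarith
    have h2 := pow_le_pow_left₀ (pow_nonneg hq _) h1 e
    have h3 : ((Finset.univ : Finset K).card : ℝ) ≤ 2 ^ e := by
      rw [Finset.card_univ]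
      exact_mod_cast hK
    have hk_p : (1 : ℝ) ≤ k := by exact_mod_cast hk
    calc _ ≤ (2 : ℝ) ^ e * (1 / 2) ^ e :=
          mul_le_mul h3 h2 (pow_nonneg (pow_nonneg hq _) _) (by positivity)
      _ = 1 := by rw [← mul_pow]; norm_num
      _ < k + 1 := by linarith

/-- ones of `z` inside `S` -/
def ones {N : ℕ} (z : Fin N → Bool) (S : Finset (Fin N)) : ℕ := (S.filter fun i => z i = true).card

theorem ones_le {N : ℕ} (z : Fin N → Bool) (S : Finset (Fin N)) : ones z S ≤ N :=
  (Finset.card_le_univ _).trans (by simp)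

theorem ones_split {N : ℕ} (z : Fin N → Bool) (S T : Finset (Fin N)) (h : T ⊆ S) :
    ones z T + ones z (S \ T) = ones z S := by
  unfold ones
  rw [← Finset.card_union_of_disjoint, ← Finset.filter_union, Finset.union_sdiff_of_subset h]
  exact Finset.disjoint_filter_filter Finset.disjoint_sdiff

/-- every multiset of `k` of the classes has a deficient set of size at most `2^s` -/
def Good {k N : ℕ} (s : ℕ) (C : Fin k → Set (Fin N → Bool)) : Prop :=
  ∀ σ : Fin k → Fin k, ∃ S : Finset (Fin N), ∃ c : Fin k → ℕ, S.card ≤ 2 ^ s ∧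
    ∑ i, c i < S.card ∧ ∀ i, ∀ z ∈ C (σ i), ones z S ≤ c i

theorem main_induction {k N e : ℕ} (hk : 1 ≤ k)
    (he : k * (N + 1) ^ (k ^ k) ≤ 2 ^ e) (s : ℕ) :
    ∀ (Z : Set (Fin N → Bool)) (C : Fin k → Set (Fin N → Bool)),
      (∀ z ∈ Z, ∃ i, z ∈ C i) → Good s C → Win k N (s * ((2 * k + 2) * e)) Z := by
  induction s with
  | zero =>
    intro Z C hZ hC
    obtain ⟨S, c, h1, h2, h3⟩ := hC id
    have hS : S.card = 1 := by
      simp only [pow_zero] at h1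
      omega
    obtain ⟨a, rfl⟩ := Finset.card_eq_one.1 hS
    rw [hS] at h2
    have hc : ∀ i, c i = 0 := by
      intro i
      have := Finset.single_le_sum (f := c) (fun _ _ => Nat.zero_le _) (Finset.mem_univ i)
      omega
    refine ⟨fun x => x a, ?_, ?_⟩
    · rw [Nat.zero_mul]
      exact ⟨a, rfl⟩
    · intro z hz
      obtain ⟨i, hi⟩ := hZ z hz
      have h4 := h3 i z hi
      rw [hc, Nat.le_zero, ones, Finset.card_eq_zero, Finset.filter_eq_empty_iff] at h4
      simpa using h4 (Finset.mem_singleton_self a)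
  | succ s ih =>
    intro Z C hZ hC
    choose S c h1 h2 h3 using hC
    have hT : ∀ σ, ∃ T ⊆ S σ, T.card = (S σ).card / 2 := fun σ =>
      Finset.exists_subset_card_eq (Nat.div_le_self _ _)
    choose T hTS hTc using hT
    haveI : Nonempty (Fin k) := ⟨⟨0, hk⟩⟩
    have hcl : ∃ cl : (Fin N → Bool) → Fin k, ∀ z ∈ Z, z ∈ C (cl z) := by
      classical
      refine ⟨fun z => if h : ∃ i, z ∈ C i then h.choose else ⟨0, hk⟩, ?_⟩
      intro z hz
      have := hZ z hz
      simp only [this, dite_true]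
      exact this.choose_spec
    obtain ⟨cl, hcl⟩ := hcl
    let τ : (Fin N → Bool) → Fin k × ((Fin k → Fin k) → Fin (N + 1)) := fun z =>
      (cl z, fun σ => ⟨ones z (T σ), Nat.lt_succ_of_le (ones_le z _)⟩)
    rw [Nat.add_mul, Nat.one_mul]
    apply win_reduce_p Z τ _ hk
    · intro A hA
      -- enumerate the types of A
      have ht : ∃ t : Fin k → Fin k × ((Fin k → Fin k) → Fin (N + 1)), ∀ a ∈ A, ∃ i, t i = a := by
        let e := A.equivFin
        refine ⟨fun i => if h : i.val < A.card then (e.symm ⟨i.val, h⟩ : _)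
          else (⟨0, hk⟩, fun _ => 0), ?_⟩
        intro a ha
        refine ⟨⟨(e ⟨a, ha⟩).val, lt_of_lt_of_le (e ⟨a, ha⟩).2 hA⟩, ?_⟩
        simp
      obtain ⟨t, ht⟩ := ht
      apply ih _ (fun i => {z | z ∈ Z ∧ τ z = t i})
      · rintro z ⟨hz, hzA⟩
        obtain ⟨i, hi⟩ := ht _ hzA
        exact ⟨i, hz, hi.symm⟩
      · intro σ_p
        let σ : Fin k → Fin k := fun i => (t (σ_p i)).1
        let a : Fin k → ℕ := fun i => min ((t (σ_p i)).2 σ).val (c σ i)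
        have key : ∀ i, ∀ z, z ∈ Z ∧ τ z = t (σ_p i) →
            ones z (T σ) = a i ∧ ones z (S σ \ T σ) ≤ c σ i - a i := by
          rintro i z ⟨hz, hzt⟩
          have e1 : cl z = σ i := by
            have := congrArg Prod.fst hzt
            exact this
          have e2 : ones z (T σ) = ((t (σ_p i)).2 σ).val := by
            rw [← hzt]
          have e3 : ones z (S σ) ≤ c σ i := h3 σ i z (e1 ▸ hcl z hz)
          have e4 := ones_split z (S σ) (T σ) (hTS σ)
          have e5 : a i = min ((t (σ_p i)).2 σ).val (c σ i) := rfl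
          rw [← e2] at e5
          omega
        have hsum : ∑ i, a i + ∑ i, (c σ i - a i) = ∑ i, c σ i := by
          rw [← Finset.sum_add_distrib]
          apply Finset.sum_congr rfl
          intro i _
          have : a i ≤ c σ i := min_le_right _ _
          omega
        have hcard : (S σ \ T σ).card = (S σ).card - (T σ).card :=
          Finset.card_sdiff_of_subset (hTS σ)
        have g1 := h1 σ
        have g2 := h2 σ
        have g3 := hTc σ
        rw [pow_succ] at g1
        by_cases hl : ∑ i, a i < (T σ).card
        · exact ⟨T σ, a, by omega, hl, fun i z hz => (key i z hz).1.le⟩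
        · exact ⟨S σ \ T σ, fun i => c σ i - a i, by omega, by
            show ∑ i, (c σ i - a i) < _
            omega,
            fun i z hz => (key i z hz).2⟩
    · simpa using he

/-- A formula that vanishes below the threshold is the threshold function. -/
theorem eq_thr {k n d : ℕ} (hk : 1 ≤ k) (hn : 1 ≤ n) (F : (Fin (k * n + 1) → Bool) → Bool)
    (hF : F ∈ Thr k (k * n + 1) d) (h0 : ∀ z, numOnes z ≤ n → F z = false) :
    THR (b := k * n + 1) (n + 1) = F := by
  funext x
  unfold THR
  by_cases hx : n + 1 ≤ numOnes x
  · rw [decide_eq_true hx]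
    by_contra hne
    have hFx : F x = false := by
      cases hh : F x
      · rfl
      · exact absurd hh.symm hne
    let B : Finset (Fin (k * n + 1)) := Finset.univ.filter fun i => ¬ x i = true
    have hB : B.card + n ≤ k * n := by
      have h1 := Finset.card_filter_add_card_filter_not (s := (Finset.univ : Finset (Fin (k * n + 1))))
        (fun i => x i = true)
      rw [Finset.card_univ, Fintype.card_fin] at h1
      unfold numOnes at hx
      change _ + B.card = _ at h1
      omega
    let e := B.equivFin
    classical
    let z : Fin k → Fin (k * n + 1) → Bool := fun j =>
      if j.val + 1 = k then x else fun i => decide (∃ h : i ∈ B, (e ⟨i, h⟩).val / n = j.val)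
    obtain ⟨i, hi⟩ := common_zero d F hF z (by
      intro j
      by_cases hj : j.val + 1 = k
      · simp only [z, hj, if_true]
        exact hFx
      · apply h0
        simp only [z, hj, if_false]
        unfold numOnes
        have : ((Finset.univ.filter fun i => decide (∃ h : i ∈ B, (e ⟨i, h⟩).val / n = j.val)
            = true)).card ≤ (Finset.Ico (j.val * n) (j.val * n + n)).card := by
          apply Finset.card_le_card_of_injOn
            (fun i => if h : i ∈ B then (e ⟨i, h⟩).val else 0)
          · intro i hi
            simp only [Finset.coe_filter, Finset.mem_univ, true_and, decide_eq_true_eq,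
              Set.mem_setOf_eq] at hi
            obtain ⟨hb, hd⟩ := hi
            simp only [hb, dite_true, Finset.coe_Ico, Set.mem_Ico]
            rw [Nat.div_eq_iff (by omega)] at hd
            have := hd.1
            have := hd.2
            constructor <;> omega
          · intro i hi i_p hi_p hh
            simp only [Finset.coe_filter, Finset.mem_univ, true_and, decide_eq_true_eq,
              Set.mem_setOf_eq] at hi hi_p
            obtain ⟨hb, hd⟩ := hi
            obtain ⟨hb_p, hd_p⟩ := hi_p
            simp only [hb, hb_p, dite_true] at hh
            have := e.injective (Fin.ext hh)
            exact congrArg Subtype.val this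
        simpa using this)
    have hxi : x i = false := by
      have := hi ⟨k - 1, by omega⟩
      have hk1 : k - 1 + 1 = k := by omega
      simpa only [z, hk1, if_true] using this
    have hiB : i ∈ B := by simp [B, hxi]
    have hlt : (e ⟨i, hiB⟩).val / n < k - 1 := by
      rw [Nat.div_lt_iff_lt_mul (by omega), Nat.sub_mul]
      have := (e ⟨i, hiB⟩).2
      omega
    have h2 := hi ⟨(e ⟨i, hiB⟩).val / n, by omega⟩
    have hne2 : ¬ ((e ⟨i, hiB⟩).val / n + 1 = k) := by omega
    simp only [z, hne2, if_false, decide_eq_false_iff_not] at h2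
    exact h2 ⟨hiB, trivial⟩
  · rw [decide_eq_false hx, h0 x (by omega)]

theorem nat_version (k n a : ℕ) (hk : 2 ≤ k) (hn : 1 ≤ n) (ha : n + 1 ≤ 2 ^ a) :
    THR (b := k * n + 1) (n + 1) ∈
      Thr k (k * n + 1) ((k + a) * ((2 * k + 2) * (k + (k + a + 1) * k ^ k))) := by
  have hk2 : k ≤ 2 ^ k := Nat.lt_two_pow_self.le
  have hN : k * n + 1 ≤ 2 ^ (k + a) := by
    rw [pow_add]
    calc k * n + 1 ≤ k * (n + 1) := by nlinarith
      _ ≤ _ := Nat.mul_le_mul hk2 ha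
  have he : k * (k * n + 1 + 1) ^ (k ^ k) ≤ 2 ^ (k + (k + a + 1) * k ^ k) := by
    rw [pow_add, pow_mul]
    apply Nat.mul_le_mul hk2
    apply Nat.pow_le_pow_left
    rw [pow_succ]
    have : 1 ≤ 2 ^ (k + a) := Nat.one_le_two_pow
    omega
  obtain ⟨F, hF, h0⟩ := main_induction (by omega) he (k + a) {z | numOnes z ≤ n}
    (fun _ => {z | numOnes z ≤ n}) (fun z hz => ⟨⟨0, by omega⟩, hz⟩) (by
      intro σ
      refine ⟨Finset.univ, fun _ => n, by simpa using hN, by simp, ?_⟩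
      intro i z hz
      exact hz)
  rw [eq_thr (by omega) hn F hF h0]
  exact hF

end ThrAux

/-- THR^{kn+1}_{n+1} is computable by an O(log² n)-depth formula
consisting only of THR^{k+1}_2 gates and variables. -/
theorem thr_in_thr2_log2depth (k : ℕ) (hk : 2 ≤ k) :
    ∃ c : ℝ, 0 < c ∧ ∀ n : ℕ, 1 ≤ n →
      THR (b := k * n + 1) (n + 1) ∈
        Thr k (k * n + 1) ⌈c * (Real.logb 2 (n + 1)) ^ 2⌉₊ := by
  refine ⟨4 * ((k + 1) * ((2 * k + 2) * (k + (k + 2) * k ^ k))), by positivity, ?_⟩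
  intro n hn
  set l := Real.logb 2 (n + 1) with hl
  have hl1 : 1 ≤ l := by
    rw [hl, Real.le_logb_iff_rpow_le (by norm_num) (by positivity)]
    have : (1 : ℝ) ≤ n := by exact_mod_cast hn
    norm_num
    linarith
  set a := ⌈l⌉₊ with ha
  have ha1 : (a : ℝ) ≤ 2 * l := by
    have := Nat.ceil_lt_add_one (a := l) (by linarith)
    linarith
  have ha2 : l ≤ a := Nat.le_ceil l
  have ha3 : 1 ≤ a := by
    have : (1 : ℝ) ≤ a := hl1.trans ha2
    exact_mod_cast this
  have ha4 : n + 1 ≤ 2 ^ a := by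
    have : ((n : ℝ) + 1) ≤ 2 ^ (a : ℝ) := by
      rw [← Real.logb_le_iff_le_rpow (by norm_num) (by positivity)]
      exact ha2
    rw [Real.rpow_natCast] at this
    exact_mod_cast this
  refine ThrAux.thr_mono ?_ (ThrAux.nat_version k n a hk hn ha4)
  have hb : (k + a) * ((2 * k + 2) * (k + (k + a + 1) * k ^ k)) ≤
      ((k + 1) * ((2 * k + 2) * (k + (k + 2) * k ^ k))) * a ^ 2 := by
    have e1 : k + a ≤ (k + 1) * a := by nlinarith
    have e2 : k + a + 1 ≤ (k + 2) * a := by nlinarith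
    have e3 : k + (k + a + 1) * k ^ k ≤ (k + (k + 2) * k ^ k) * a := by
      have := Nat.mul_le_mul_right (k ^ k) e2
      nlinarith
    calc _ ≤ ((k + 1) * a) * ((2 * k + 2) * ((k + (k + 2) * k ^ k) * a)) :=
          Nat.mul_le_mul e1 (Nat.mul_le_mul_left _ e3)
      _ = _ := by ring
  refine hb.trans ?_
  have : ((((k + 1) * ((2 * k + 2) * (k + (k + 2) * k ^ k))) * a ^ 2 : ℕ) : ℝ) ≤
      4 * ((k + 1) * ((2 * k + 2) * (k + (k + 2) * k ^ k))) * l ^ 2 := by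
    push_cast
    have hsq : (a : ℝ) ^ 2 ≤ (2 * l) ^ 2 := pow_le_pow_left₀ (by positivity) ha1 2
    have hpos : (0 : ℝ) ≤ ((k + 1) * ((2 * k + 2) * (k + (k + 2) * k ^ k))) := by positivity
    have := mul_le_mul_of_nonneg_left hsq hpos
    linarith
  exact_mod_cast this.trans (Nat.le_ceil _)
end

section
/- For every k ≥ 2, n ≥ 1 and every Boolean function f : (Fin n → Bool) → Bool: f ∈ Q_k if and only if there exist d ∈ ℕ and a function C ∈ Thr(k,n,d) with C ≤ f. (Proposition 'Q_k_char': Q_k equals the set of Boolean functions lower-bounded by a circuit consisting only of THR^{k+1}_2 gates and variables.) -/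
/-- `f ∈ Q_k`: any k vectors on which f is false have a common zero coordinate. -/
def QkMem (k n : ℕ) (f : (Fin n → Bool) → Bool) : Prop :=
  ∀ x : Fin k → Fin n → Bool, (∀ i, f (x i) = false) →
    ∃ j, ∀ i, x i j = false

/-- `C ≤ f`: C is false wherever f is false. -/
def circLE {n : ℕ} (C f : (Fin n → Bool) → Bool) : Prop :=
  ∀ x, f x = false → C x = false

theorem THRgate_false_iff {k : ℕ} (v : Fin (k + 1) → Bool) :
    THRgate k v = false ↔ ∀ a b, v a = true → v b = true → a = b := by
  unfold THRgate numOnes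
  rw [decide_eq_false_iff_not, not_le, Nat.lt_succ_iff, Finset.card_le_one]
  simp only [Finset.mem_filter, Finset.mem_univ, true_and]
  exact ⟨fun h a b ha hb => h a ha b hb, fun h a ha b hb => h a b ha hb⟩

theorem Thr_mono (k n : ℕ) {d e : ℕ} (h : d ≤ e) : Thr k n d ⊆ Thr k n e := by
  induction e, h using Nat.le_induction with
  | base => exact subset_rfl
  | succ e _ ih => exact ih.trans (fun x hx => Or.inl hx)

theorem Thr_QkMem (k n d : ℕ) : ∀ C ∈ Thr k n d, QkMem k n C := by
  induction d with
  | zero =>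
    rintro C ⟨i, rfl⟩ x hx
    exact ⟨i, hx⟩
  | succ d ih =>
    rintro C (hC | ⟨g, hg, rfl⟩)
    · exact ih C hC
    · intro x hx
      have key : ∃ j, ∀ i, g j (x i) = false := by
        by_contra hcon
        push Not at hcon
        choose p hp using hcon
        have hinj : Function.Injective p := by
          intro a b hab
          refine (THRgate_false_iff _).1 (hx (p a)) a b ?_ ?_
          · simpa using hp a
          · rw [hab]
            simpa using hp b
        have := Fintype.card_le_of_injective p hinj
        simp at this
      obtain ⟨j, hj⟩ := key
      exact ih (g j) (hg j) x hj

theorem exists_circuit (k n : ℕ) (hn : 1 ≤ n) (m : ℕ) :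
    ∀ S : Finset (Fin n → Bool), S.card = m →
    (∀ x : Fin k → Fin n → Bool, (∀ i, x i ∈ S) → ∃ j, ∀ i, x i j = false) →
    ∃ d, ∃ C ∈ Thr k n d, ∀ x ∈ S, C x = false := by
  induction m with
  | zero =>
    intro S hS _
    rw [Finset.card_eq_zero] at hS
    subst hS
    exact ⟨0, fun x => x ⟨0, hn⟩, ⟨_, rfl⟩, by simp⟩
  | succ m ih =>
    intro S hS hQ
    by_cases hm : m + 1 ≤ k
    · have hne : Nonempty S := by
        rw [Finset.nonempty_coe_sort, ← Finset.card_pos]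
        omega
      obtain ⟨e⟩ : Nonempty (S ↪ Fin k) :=
        Function.Embedding.nonempty_of_card_le (by simp; omega)
      obtain ⟨j, hj⟩ := hQ (fun i => (Function.invFun e i : S)) (fun i => Subtype.prop _)
      refine ⟨0, fun x => x j, ⟨j, rfl⟩, fun x hx => ?_⟩
      obtain ⟨i, hi⟩ := Function.invFun_surjective e.injective ⟨x, hx⟩
      have := hj i
      rw [hi] at this
      exact this
    · obtain ⟨s⟩ : Nonempty (Fin (k + 1) ↪ S) :=
        Function.Embedding.nonempty_of_card_le (by simp; omega)
      have H : ∀ j, ∃ d, ∃ C ∈ Thr k n d, ∀ x ∈ S.erase (s j : Fin n → Bool), C x = false := by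
        intro j
        apply ih
        · rw [Finset.card_erase_of_mem (s j).2]
          omega
        · exact fun x hx => hQ x (fun i => Finset.mem_of_mem_erase (hx i))
      choose d g hg hgS using H
      refine ⟨(∑ j, d j) + 1, _, Or.inr ⟨g, fun j => ?_, rfl⟩, fun x hx => ?_⟩
      · exact Thr_mono k n
          (Finset.single_le_sum (f := d) (fun _ _ => Nat.zero_le _) (Finset.mem_univ j)) (hg j)
      · rw [THRgate_false_iff]
        have aux : ∀ a, g a x = true → x = s a := by
          intro a ha
          by_contra hne
          have := hgS a x (Finset.mem_erase.2 ⟨hne, hx⟩)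
          simp [this] at ha
        intro a b ha hb
        exact s.injective (Subtype.ext ((aux a ha).symm.trans (aux b hb)))

/-- Q_k equals the set of Boolean functions lower-bounded by a
circuit consisting only of THR^{k+1}_2 gates and variables. -/
theorem Qk_char (k n : ℕ) (hk : 2 ≤ k) (hn : 1 ≤ n)
    (f : (Fin n → Bool) → Bool) :
    QkMem k n f ↔ ∃ d : ℕ, ∃ C ∈ Thr k n d, circLE C f := by
  constructor
  · intro hf
    obtain ⟨d, C, hC, h⟩ := exists_circuit k n hn _
      (Finset.univ.filter fun x => f x = false) rfl
      (fun x hx => hf x (fun i => by simpa using hx i))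
    exact ⟨d, C, hC, fun x hx => h x (by simpa using hx)⟩
  · rintro ⟨d, C, hC, h⟩ x hx
    exact Thr_QkMem k n d C hC x (fun i => h _ (hx i))
end

section
/- For every k ≥ 2, n ≥ 1 and every Boolean function f : (Fin n → Bool) → Bool: f ∈ R_k if and only if there exist d ∈ ℕ and a function C ∈ ThrLit(k,n,d) with C ≤ f. (Proposition 'R_k_char': R_k equals the set of Boolean functions lower-bounded by a circuit consisting only of THR^{k+1}_2 gates and literals.) -/
/-- `f ∈ R_k`: on any k vectors on which f is false there is a coordinate where
all k vectors agree. -/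
def RkMem (k n : ℕ) (f : (Fin n → Bool) → Bool) : Prop :=
  ∀ x : Fin k → Fin n → Bool, (∀ i, f (x i) = false) →
    ∃ j, ∃ b : Bool, ∀ i, x i j = b

/-- `ThrLit k n d` : Boolean functions on n variables computable by depth-d
formulas consisting only of THR^{k+1}_2 gates and literals. -/
def ThrLit (k n : ℕ) : ℕ → Set ((Fin n → Bool) → Bool)
  | 0 => { f | ∃ i : Fin n, f = (fun x => x i) ∨ f = (fun x => !(x i)) }
  | d + 1 => ThrLit k n d ∪
      { f | ∃ g : Fin (k + 1) → ((Fin n → Bool) → Bool),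
          (∀ j, g j ∈ ThrLit k n d) ∧ f = fun x => THRgate k (fun j => g j x) }

theorem ThrLit_mono (k n : ℕ) {d e : ℕ} (h : d ≤ e) : ThrLit k n d ⊆ ThrLit k n e := by
  induction h with
  | refl => exact subset_rfl
  | step _ ih => exact fun f hf => Or.inl (ih hf)

theorem THRgate_false {k : ℕ} (v : Fin (k + 1) → Bool) :
    THRgate k v = false ↔ ∀ i j, v i = true → v j = true → i = j := by
  unfold THRgate numOnes
  rw [decide_eq_false_iff_not, not_le, Nat.lt_succ_iff, Finset.card_le_one]
  simp only [Finset.mem_filter, Finset.mem_univ, true_and]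
  exact ⟨fun h i j hi hj => h i hi j hj, fun h i hi j hj => h i j hi hj⟩

theorem ThrLit_RkMem (k n d : ℕ) : ∀ C ∈ ThrLit k n d, RkMem k n C := by
  induction d with
  | zero =>
    rintro C ⟨i, rfl | rfl⟩ x hx
    · exact ⟨i, false, hx⟩
    · exact ⟨i, true, fun j => by simpa using hx j⟩
  | succ d ih =>
    rintro C (hC | ⟨g, hg, rfl⟩)
    · exact ih C hC
    · intro x hx
      have key : ∃ j, ∀ i, g j (x i) = false := by
        by_contra hcon
        push Not at hcon
        choose p hp using hcon
        obtain ⟨a, b, hab, hpab⟩ :=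
          Fintype.exists_ne_map_eq_of_card_lt p (by simp)
        refine hab ((THRgate_false _).1 (hx (p a)) a b ?_ ?_)
        · simpa using hp a
        · rw [hpab]; simpa using hp b
      obtain ⟨j, hj⟩ := key
      exact ih _ (hg j) x hj

theorem exists_ThrLit_zero (k n : ℕ) (hn : 1 ≤ n) (f : (Fin n → Bool) → Bool)
    (hf : RkMem k n f) (m : ℕ) : ∀ S : Finset (Fin n → Bool), S.card = m →
    (∀ x ∈ S, f x = false) → ∃ d, ∃ C ∈ ThrLit k n d, ∀ x ∈ S, C x = false := by
  induction m with
  | zero =>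
    intro S hS _
    rw [Finset.card_eq_zero] at hS
    subst hS
    exact ⟨0, fun x => x ⟨0, hn⟩, ⟨_, Or.inl rfl⟩, by simp⟩
  | succ m ih =>
    intro S hS hSf
    by_cases hle : S.card ≤ k
    · have hne : Nonempty S := (Finset.card_pos.1 (by omega)).to_subtype
      obtain ⟨e⟩ : Nonempty (S ↪ Fin k) :=
        Function.Embedding.nonempty_of_card_le (by simpa using hle)
      have hinv := Function.leftInverse_invFun e.injective
      obtain ⟨j, b, hb⟩ := hf (fun i => (Function.invFun e i : S))
        (fun i => hSf _ (Function.invFun e i).2)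
      have hb' : ∀ x ∈ S, x j = b := by
        intro x hx
        have h := hb (e ⟨x, hx⟩)
        rwa [hinv] at h
      cases b with
      | false => exact ⟨0, fun x => x j, ⟨j, Or.inl rfl⟩, hb'⟩
      | true => exact ⟨0, fun x => !(x j), ⟨j, Or.inr rfl⟩, fun x hx => by simp [hb' x hx]⟩
    · obtain ⟨a⟩ : Nonempty (Fin (k + 1) ↪ S) :=
        Function.Embedding.nonempty_of_card_le (by simp; omega)
      have H : ∀ i, ∃ d, ∃ C ∈ ThrLit k n d, ∀ x ∈ S.erase (a i), C x = false := by
        intro i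
        refine ih _ ?_ ?_
        · rw [Finset.card_erase_of_mem (a i).2, hS]; rfl
        · exact fun x hx => hSf x (Finset.mem_of_mem_erase hx)
      choose d C hC hz using H
      refine ⟨Finset.univ.sup d + 1, fun x => THRgate k (fun j => C j x),
        Or.inr ⟨C, fun j => ThrLit_mono k n (Finset.le_sup (Finset.mem_univ j)) (hC j), rfl⟩, ?_⟩
      intro x hx
      have hcase : ∀ i, C i x = true → x = a i := by
        intro i hi
        by_contra hne
        have := hz i x (Finset.mem_erase.2 ⟨hne, hx⟩)
        simp [this] at hi
      refine (THRgate_false _).2 fun i j hi hj => a.injective (Subtype.ext ?_)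
      exact (hcase i hi).symm.trans (hcase j hj)

/-- R_k equals the set of Boolean functions lower-bounded by a
circuit consisting only of THR^{k+1}_2 gates and literals. -/
theorem Rk_char (k n : ℕ) (hk : 2 ≤ k) (hn : 1 ≤ n)
    (f : (Fin n → Bool) → Bool) :
    RkMem k n f ↔ ∃ d : ℕ, ∃ C ∈ ThrLit k n d, circLE C f := by
  constructor
  · intro hf
    obtain ⟨d, C, hC, hz⟩ := exists_ThrLit_zero k n hn f hf _
      (Finset.univ.filter fun x => f x = false) rfl (by simp)
    exact ⟨d, C, hC, fun x hx => hz x (by simpa using hx)⟩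
  · rintro ⟨d, C, hC, hle⟩ x hx
    exact ThrLit_RkMem k n d C hC x fun i => hle _ (hx i)
end

section
/- There is a constant c > 0 such that for every n ≥ 1, taking N = 2n+1, Reach ⌈c · log₂(n+1)⌉ (Finset.univ : Finset (Fin N)) holds. (This is the existence part of the paper's tree lemma: there is a 3-ary tree of depth O(log n) whose root is labeled [2n+1], in which the labels of the three children of any node cover each element of the node's label at least twice, and whose leaf labels have size 2. The paper additionally shows the tree is polynomial-time computable.) -/
/-- `Reach d A`: there is a 3-ary tree of depth at most d with root labeled A,
in which the labels of the three children of each node cover each element of the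
node's label at least twice, and all leaf labels have size 2. -/
def Reach (N : ℕ) : ℕ → Finset (Fin N) → Prop
  | 0, A => A.card = 2
  | d + 1, A => A.card = 2 ∨
      ∃ B₁ B₂ B₃ : Finset (Fin N),
        (∀ a ∈ A, 2 ≤ ((if a ∈ B₁ then 1 else 0) + (if a ∈ B₂ then 1 else 0) +
          (if a ∈ B₃ then 1 else 0) : ℕ)) ∧
        Reach N d B₁ ∧ Reach N d B₂ ∧ Reach N d B₃

theorem reach_succ {N : ℕ} : ∀ (d : ℕ) (A : Finset (Fin N)), Reach N d A → Reach N (d + 1) A := by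
  intro d
  induction d with
  | zero => intro A h; exact Or.inl h
  | succ d ih =>
    intro A h
    rcases h with h | ⟨B₁, B₂, B₃, hc, h1, h2, h3⟩
    · exact Or.inl h
    · exact Or.inr ⟨B₁, B₂, B₃, hc, ih _ h1, ih _ h2, ih _ h3⟩

theorem reach_mono {N : ℕ} {d e : ℕ} (hde : d ≤ e) (A : Finset (Fin N)) (h : Reach N d A) :
    Reach N e A := by
  induction hde with
  | refl => exact h
  | step _ ih => exact reach_succ _ _ ih

/-- Split a set of size at least 3 into three nearly equal parts and take complements. -/
theorem reach_split {N : ℕ} (d : ℕ) (A : Finset (Fin N)) (hA : 2 ≤ A.card)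
    (H : ∀ B : Finset (Fin N), 2 ≤ B.card → 3 * B.card ≤ 2 * A.card + 2 → Reach N d B) :
    Reach N (d + 1) A := by
  by_cases h2 : A.card = 2
  · exact Or.inl h2
  obtain ⟨C, hC, hCc⟩ := Finset.exists_subset_card_eq (s := A) (n := A.card / 3) (by omega)
  have hAC : (A \ C).card = A.card - A.card / 3 := by
    rw [Finset.card_sdiff_of_subset hC, hCc]
  obtain ⟨D, hD, hDc⟩ := Finset.exists_subset_card_eq (s := A \ C) (n := (A.card + 1) / 3)
    (by omega)
  have hDA : D ⊆ A := hD.trans Finset.sdiff_subset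
  have hAD : (A \ D).card = A.card - (A.card + 1) / 3 := by
    rw [Finset.card_sdiff_of_subset hDA, hDc]
  have hdis : Disjoint C D := by
    rw [Finset.disjoint_left]
    intro x hx hx'
    exact (Finset.mem_sdiff.1 (hD hx')).2 hx
  have hCD : (C ∪ D).card = A.card / 3 + (A.card + 1) / 3 := by
    rw [Finset.card_union_of_disjoint hdis, hCc, hDc]
  refine Or.inr ⟨A \ C, A \ D, C ∪ D, ?_, H _ (by omega) (by omega), H _ (by omega) (by omega),
    H _ (by omega) (by omega)⟩
  intro a ha
  have hno : a ∈ C → a ∉ D := fun h => Finset.disjoint_left.1 hdis h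
  by_cases h1 : a ∈ C <;> by_cases h3 : a ∈ D
    <;> simp [ha, h1, h3] at hno ⊢

theorem reach_pow {N : ℕ} (k : ℕ) : ∀ A : Finset (Fin N), 2 ≤ A.card → A.card < 2 ^ k + 2 →
    Reach N (2 * k) A := by
  induction k with
  | zero => intro A h1 h2; show A.card = 2; omega
  | succ k ih =>
    intro A h1 h2
    rw [pow_succ] at h2
    refine reach_split (2 * k + 1) A h1 fun B hB hBA => ?_
    refine reach_split (2 * k) B hB fun E hE hEB => ?_
    exact ih E hE (by omega)

/-- the tree lemma — starting from [2n+1] one can reach leaf labels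
of size 2 within depth O(log n). -/
theorem tree_lemma :
    ∃ c : ℝ, 0 < c ∧ ∀ n : ℕ, 1 ≤ n →
      Reach (2 * n + 1) ⌈c * Real.logb 2 (n + 1)⌉₊
        (Finset.univ : Finset (Fin (2 * n + 1))) := by
  refine ⟨6, by norm_num, fun n hn => ?_⟩
  have hlt : n + 1 < 2 ^ (Nat.log 2 (n + 1) + 1) := Nat.lt_pow_succ_log_self (by norm_num) _
  refine reach_mono ?_ _ (reach_pow (Nat.log 2 (n + 1) + 2) Finset.univ ?_ ?_)
  · have h1 : ((Nat.log 2 (n + 1) : ℕ) : ℝ) ≤ Real.logb 2 (n + 1) := by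
      have := Real.natLog_le_logb (n + 1) 2
      push_cast at this
      exact this
    have h2 : (1 : ℝ) ≤ Real.logb 2 (n + 1) := by
      rw [Real.le_logb_iff_rpow_le (by norm_num) (by positivity)]
      have : (1 : ℝ) ≤ n := by exact_mod_cast hn
      norm_num
      linarith
    have h3 := Nat.le_ceil (6 * Real.logb 2 ((n : ℝ) + 1))
    have h4 : ((2 * (Nat.log 2 (n + 1) + 2) : ℕ) : ℝ) ≤
        (⌈6 * Real.logb 2 ((n : ℝ) + 1)⌉₊ : ℝ) := by
      push_cast
      linarith
    exact_mod_cast h4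
  · simp; omega
  · rw [pow_succ]
    simp
    omega
end

section
/- For every finite set A (a Finset in an arbitrary type) with |A| ≥ 3, there exist subsets B₁, B₂, B₃ ⊆ A such that: every element of A belongs to at least two of B₁, B₂, B₃; |B_i| ≥ 2 for each i ∈ {1,2,3}; and 5·|B_i| ≤ 4·|A| for each i ∈ {1,2,3}. (This is the one-step splitting claim in the proof of the paper's tree lemma: split A into three disjoint parts A₁, A₂, A₃ of sizes ⌊|A|/3⌋, ⌊|A|/3⌋, |A| − 2⌊|A|/3⌋ and take the three pairwise unions.) -/
/-- the one-step splitting claim of the tree lemma. -/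
theorem tree_split {α : Type*} [DecidableEq α] (A : Finset α) (hA : 3 ≤ A.card) :
    ∃ B₁ B₂ B₃ : Finset α, B₁ ⊆ A ∧ B₂ ⊆ A ∧ B₃ ⊆ A ∧
      (∀ a ∈ A, 2 ≤ ((if a ∈ B₁ then 1 else 0) + (if a ∈ B₂ then 1 else 0) +
        (if a ∈ B₃ then 1 else 0) : ℕ)) ∧
      (2 ≤ B₁.card ∧ 2 ≤ B₂.card ∧ 2 ≤ B₃.card) ∧
      (5 * B₁.card ≤ 4 * A.card ∧ 5 * B₂.card ≤ 4 * A.card ∧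
        5 * B₃.card ≤ 4 * A.card) := by
  obtain ⟨A₁, h1, c1⟩ := Finset.exists_subset_card_eq (s := A) (n := A.card / 3) (by omega)
  have d1 := Finset.card_sdiff_of_subset h1
  obtain ⟨A₂, h2, c2⟩ := Finset.exists_subset_card_eq (s := A \ A₁) (n := A.card / 3) (by omega)
  have h2A : A₂ ⊆ A := h2.trans Finset.sdiff_subset
  have hd : Disjoint A₁ A₂ := Finset.disjoint_of_subset_right h2 Finset.disjoint_sdiff
  have d2 := Finset.card_sdiff_of_subset h2A
  have d3 := Finset.card_union_of_disjoint hd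
  refine ⟨A \ A₁, A \ A₂, A₁ ∪ A₂, Finset.sdiff_subset, Finset.sdiff_subset,
    Finset.union_subset h1 h2A, ?_, ⟨by omega, by omega, by omega⟩,
    ⟨by omega, by omega, by omega⟩⟩
  intro a ha
  have hn : ¬ (a ∈ A₁ ∧ a ∈ A₂) := fun h => Finset.disjoint_left.mp hd h.1 h.2
  by_cases x : a ∈ A₁ <;> by_cases y : a ∈ A₂ <;> simp_all
end

section
/- Let f : ℝ → ℝ be defined by f(t) = 3t² − 2t³. Then for every real p with 0 ≤ p ≤ 1 and every m ∈ ℕ, the m-fold iterate satisfies 0 ≤ f^[m](p) ≤ 1 and 3 · f^[m](p) ≤ (3p)^(2^m). (This is the key amplification estimate in the probabilistic proof of the paper's Valiant-type lemma, based on the inequality 3·f(t) ≤ (3t)² for t ≥ 0.) -/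
/-- the amplification estimate for iterates of t ↦ 3t² − 2t³. -/
theorem valiant_amplification (p : ℝ) (hp0 : 0 ≤ p) (hp1 : p ≤ 1) (m : ℕ) :
    0 ≤ (fun t : ℝ => 3 * t ^ 2 - 2 * t ^ 3)^[m] p ∧
    (fun t : ℝ => 3 * t ^ 2 - 2 * t ^ 3)^[m] p ≤ 1 ∧
    3 * (fun t : ℝ => 3 * t ^ 2 - 2 * t ^ 3)^[m] p ≤ (3 * p) ^ (2 ^ m) := by
  induction m with
  | zero => simp [hp0, hp1]
  | succ k ih =>
    rw [Function.iterate_succ_apply']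
    generalize (fun t : ℝ => 3 * t ^ 2 - 2 * t ^ 3)^[k] p = x at ih ⊢
    obtain ⟨h0, h1, h2⟩ := ih
    have h3 : 0 ≤ x ^ 3 := pow_nonneg h0 3
    refine ⟨?_, ?_, ?_⟩
    · change 0 ≤ 3 * x ^ 2 - 2 * x ^ 3
      nlinarith [mul_nonneg (sq_nonneg x) (sub_nonneg.2 h1), sq_nonneg x]
    · change 3 * x ^ 2 - 2 * x ^ 3 ≤ 1
      have h4 : 0 ≤ (1 - x) ^ 2 * (1 + 2 * x) := by positivity
      nlinarith [h4]
    · change 3 * (3 * x ^ 2 - 2 * x ^ 3) ≤ _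
      have h5 : (3 * x) ^ 2 ≤ ((3 * p) ^ (2 ^ k)) ^ 2 :=
        pow_le_pow_left₀ (by positivity) h2 2
      rw [pow_succ 2 k, pow_mul]
      nlinarith [h5]
end

section
/- For every n ≥ 1 there exists a leaf labeling ℓ : (Fin d → Fin 3) → Fin (2n+1) × Fin (2n+1), where d = ⌈log₂ n⌉ + 10, such that for every x : Fin (2n+1) → Bool with at most n ones, Eval_d(ℓ)(x) = false. (Paper's Lemma 'valiant_lemma': there exists a formula which is a complete ternary tree of depth ⌈log₂ n⌉ + 10 with MAJ₃ gates at internal nodes and conjunctions of two variables at leaves, evaluating to 0 on every input with at most n ones.) -/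
/-- Evaluation of a complete ternary tree of depth d with MAJ₃ gates at internal
nodes and conjunctions of two variables (given by the leaf labeling ℓ) at leaves. -/
def EvalTree (N : ℕ) : (d : ℕ) → ((Fin d → Fin 3) → Fin N × Fin N) →
    (Fin N → Bool) → Bool
  | 0, ℓ, x => x (ℓ (fun i => i.elim0)).1 && x (ℓ (fun i => i.elim0)).2
  | d + 1, ℓ, x =>
      maj3 (EvalTree N d (fun w => ℓ (Fin.cons 0 w)) x)
           (EvalTree N d (fun w => ℓ (Fin.cons 1 w)) x)
           (EvalTree N d (fun w => ℓ (Fin.cons 2 w)) x)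

/-- The set of labelings on which the tree evaluates to true. -/
def badSet (N d : ℕ) (x : Fin N → Bool) : Finset ((Fin d → Fin 3) → Fin N × Fin N) :=
  Finset.univ.filter fun ℓ => EvalTree N d ℓ x = true

lemma badSet_succ (N d : ℕ) (x : Fin N → Bool) :
    (badSet N (d + 1) x).card ≤
      3 * (badSet N d x).card ^ 2 * Fintype.card ((Fin d → Fin 3) → Fin N × Fin N) := by
  classical
  let A := (Fin d → Fin 3) → Fin N × Fin N
  let S : Finset A := badSet N d x
  let U : Finset A := Finset.univ
  let φ : ((Fin (d + 1) → Fin 3) → Fin N × Fin N) → A × A × A := fun ℓ =>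
    (fun w => ℓ (Fin.cons 0 w), fun w => ℓ (Fin.cons 1 w), fun w => ℓ (Fin.cons 2 w))
  have hφ : Function.Injective φ := by
    intro a b hab
    simp only [φ, Prod.mk.injEq] at hab
    obtain ⟨h0, h1, h2⟩ := hab
    funext w
    rw [← Fin.cons_self_tail w]
    generalize w 0 = c
    fin_cases c
    · exact congrFun h0 (Fin.tail w)
    · exact congrFun h1 (Fin.tail w)
    · exact congrFun h2 (Fin.tail w)
  have hsub : (badSet N (d + 1) x).image φ ⊆
      (S ×ˢ (S ×ˢ U)) ∪ ((S ×ˢ (U ×ˢ S)) ∪ (U ×ˢ (S ×ˢ S))) := by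
    intro y hy
    obtain ⟨ℓ, hℓ, rfl⟩ := Finset.mem_image.1 hy
    simp only [badSet, Finset.mem_filter, Finset.mem_univ, true_and, EvalTree, maj3,
      Bool.or_eq_true, Bool.and_eq_true] at hℓ
    simp only [φ, S, U, badSet, Finset.mem_union, Finset.mem_product, Finset.mem_filter,
      Finset.mem_univ, true_and, and_true]
    tauto
  have h := Finset.card_le_card hsub
  rw [Finset.card_image_of_injective _ hφ] at h
  have h1 := Finset.card_union_le (S ×ˢ (S ×ˢ U)) ((S ×ˢ (U ×ˢ S)) ∪ (U ×ˢ (S ×ˢ S)))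
  have h2 := Finset.card_union_le (S ×ˢ (U ×ˢ S)) (U ×ˢ (S ×ˢ S))
  simp only [Finset.card_product] at h1 h2
  have hU : U.card = Fintype.card A := Finset.card_univ
  rw [hU] at h1 h2
  change _ ≤ 3 * S.card ^ 2 * Fintype.card A
  nlinarith

lemma badSet_zero (N : ℕ) (x : Fin N → Bool) :
    (badSet N 0 x).card ≤ numOnes x ^ 2 := by
  classical
  let O := Finset.univ.filter fun i => x i = true
  have : (badSet N 0 x).card ≤ (O ×ˢ O).card := by
    apply Finset.card_le_card_of_injOn (fun ℓ => ℓ (fun i => i.elim0))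
    · intro ℓ hℓ
      simpa [badSet, EvalTree, O] using hℓ
    · intro a _ b _ hab
      funext w
      have : w = fun i => i.elim0 := Subsingleton.elim _ _
      rw [this]
      exact hab
  rw [Finset.card_product] at this
  rw [sq]
  exact this

lemma badSet_bound (n d : ℕ) (x : Fin (2 * n + 1) → Bool) (hx : numOnes x ≤ n) :
    3 * (badSet (2 * n + 1) d x).card * 4 ^ (2 ^ d) ≤
      3 ^ (2 ^ d) *
        Fintype.card ((Fin d → Fin 3) → Fin (2 * n + 1) × Fin (2 * n + 1)) := by
  induction d with
  | zero =>
    have h := badSet_zero _ x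
    have h2 : numOnes x ^ 2 ≤ n ^ 2 := Nat.pow_le_pow_left hx 2
    simp
    nlinarith
  | succ d ih =>
    have h := badSet_succ _ d x
    have hM : Fintype.card ((Fin (d + 1) → Fin 3) → Fin (2 * n + 1) × Fin (2 * n + 1)) =
        Fintype.card ((Fin d → Fin 3) → Fin (2 * n + 1) × Fin (2 * n + 1)) ^ 3 := by
      simp only [Fintype.card_fun, Fintype.card_fin]
      rw [← pow_mul, ← pow_succ]
    rw [hM]
    generalize Fintype.card ((Fin d → Fin 3) → Fin (2 * n + 1) × Fin (2 * n + 1)) = M at *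
    generalize (badSet (2 * n + 1) d x).card = T at *
    rw [pow_succ 2 d, pow_mul, pow_mul]
    generalize 4 ^ 2 ^ d = F at *
    generalize 3 ^ 2 ^ d = G at *
    calc _ ≤ 3 * (3 * T ^ 2 * M) * F ^ 2 := by gcongr
      _ = (3 * T * F) ^ 2 * M := by ring
      _ ≤ (G * M) ^ 2 * M := by gcongr
      _ = _ := by ring

lemma final_arith (n K : ℕ) (hn : 1 ≤ n) (hK : 8 * n ≤ K) :
    2 ^ (2 * n + 1) * 3 ^ K ≤ 4 ^ K := by
  obtain ⟨k, rfl⟩ := Nat.exists_eq_add_of_le hK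
  calc 2 ^ (2 * n + 1) * 3 ^ (8 * n + k) ≤ 2 ^ (3 * n) * 3 ^ (8 * n + k) := by
        gcongr
        · norm_num
        · omega
    _ = (2 ^ 3 * 3 ^ 8) ^ n * 3 ^ k := by rw [mul_pow, ← pow_mul, ← pow_mul, pow_add]; ring
    _ ≤ (4 ^ 8) ^ n * 4 ^ k := by gcongr <;> norm_num
    _ = _ := by rw [← pow_mul, ← pow_add]

/-- Valiant-type lemma — there is a complete ternary tree of depth
⌈log₂ n⌉ + 10 of MAJ₃ gates with conjunctions of two variables at the leaves
which evaluates to false on every input with at most n ones. -/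
theorem valiant_lemma (n : ℕ) (hn : 1 ≤ n) :
    ∃ ℓ : (Fin (Nat.clog 2 n + 10) → Fin 3) →
        Fin (2 * n + 1) × Fin (2 * n + 1),
      ∀ x : Fin (2 * n + 1) → Bool, numOnes x ≤ n →
        EvalTree (2 * n + 1) (Nat.clog 2 n + 10) ℓ x = false := by
  classical
  have hD : 8 * n ≤ 2 ^ (Nat.clog 2 n + 10) := by
    have := Nat.le_pow_clog (b := 2) (by norm_num) n
    rw [pow_add]
    omega
  generalize Nat.clog 2 n + 10 = D at *
  have har := final_arith n (2 ^ D) hn hD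
  let X := Finset.univ.filter fun x : Fin (2 * n + 1) → Bool => numOnes x ≤ n
  let M := Fintype.card ((Fin D → Fin 3) → Fin (2 * n + 1) × Fin (2 * n + 1))
  have hMpos : 0 < M := Fintype.card_pos
  have hXc : X.card ≤ 2 ^ (2 * n + 1) := by
    refine (Finset.card_le_univ X).trans ?_
    simp
  have hB : (X.biUnion fun x => badSet (2 * n + 1) D x).card < M := by
    have h1 : (X.biUnion fun x => badSet (2 * n + 1) D x).card ≤
        ∑ x ∈ X, (badSet (2 * n + 1) D x).card := Finset.card_biUnion_le
    have h2 : 3 * 4 ^ (2 ^ D) * ∑ x ∈ X, (badSet (2 * n + 1) D x).card ≤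
        X.card * (3 ^ (2 ^ D) * M) := by
      rw [Finset.mul_sum, ← smul_eq_mul X.card]
      refine Finset.sum_le_card_nsmul _ _ _ fun x hx => ?_
      have := badSet_bound n D x (Finset.mem_filter.1 hx).2
      calc _ = 3 * (badSet (2 * n + 1) D x).card * 4 ^ (2 ^ D) := by ring
        _ ≤ _ := this
    have h3 : X.card * (3 ^ (2 ^ D) * M) ≤ 4 ^ (2 ^ D) * M := by
      calc _ ≤ 2 ^ (2 * n + 1) * (3 ^ (2 ^ D) * M) := by gcongr
        _ = (2 ^ (2 * n + 1) * 3 ^ (2 ^ D)) * M := by ring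
        _ ≤ _ := by gcongr
    have hF : 0 < 4 ^ (2 ^ D) := by positivity
    have h4 : 3 * ∑ x ∈ X, (badSet (2 * n + 1) D x).card ≤ M := by
      refine le_of_mul_le_mul_left (a := 4 ^ (2 ^ D)) ?_ hF
      calc _ = 3 * 4 ^ (2 ^ D) * ∑ x ∈ X, (badSet (2 * n + 1) D x).card := by ring
        _ ≤ _ := h2.trans h3
    omega
  by_contra hcon
  push Not at hcon
  have : (X.biUnion fun x => badSet (2 * n + 1) D x) = Finset.univ := by
    ext ℓ
    obtain ⟨x, hx, hx2⟩ := hcon ℓ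
    simp only [Finset.mem_biUnion, Finset.mem_univ, iff_true]
    exact ⟨x, by simp [X, hx], by simpa [badSet] using hx2⟩
  rw [this, Finset.card_univ] at hB
  exact lt_irrefl _ hB
end

section
/- Fix k ≥ 2, n ≥ 1 and d ∈ ℕ, and let g ∈ Thr(k, k·n+1, d). If g(x) = false for every x : Fin (k·n+1) → Bool with at most n ones, then g(x) = true for every x with at least n+1 ones; in other words, g coincides with THR^{kn+1}_{n+1}. (This is the claim, proved inside Corollary 'weak version', that any formula over THR^{k+1}_2 gates and variables lower-bounding THR^{kn+1}_{n+1} actually computes it.) -/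
theorem common_zero (k N : ℕ) : ∀ (d : ℕ) (g : (Fin N → Bool) → Bool), g ∈ Thr k N d →
    ∀ z : Fin k → (Fin N → Bool), (∀ l, g (z l) = false) → ∃ i, ∀ l, z l i = false := by
  intro d
  induction d with
  | zero =>
    rintro g ⟨i, rfl⟩ z hz
    exact ⟨i, hz⟩
  | succ d ih =>
    rintro g (hg | ⟨h, hh, rfl⟩) z hz
    · exact ih g hg z hz
    · suffices H : ∃ j, ∀ l, h j (z l) = false by
        obtain ⟨j, hj⟩ := H
        exact ih (h j) (hh j) z hj
      by_contra! hcon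
      choose f hf using hcon
      have hinj : Function.Injective f := by
        intro a b hab
        by_contra hne
        have h1 := hz (f a)
        simp only [THRgate, numOnes, decide_eq_false_iff_not, not_le] at h1
        have h2 : ({a, b} : Finset (Fin (k + 1))) ⊆
            Finset.univ.filter fun i => h i (z (f a)) = true := by
          intro c hc
          simp only [Finset.mem_insert, Finset.mem_singleton] at hc
          rcases hc with rfl | rfl
          · simpa using hf c
          · simpa [hab] using hf c
        have h3 := Finset.card_le_card h2
        rw [Finset.card_pair hne] at h3
        omega
      have := Fintype.card_le_of_injective f hinj
      simp at this

/-- any formula over THR^{k+1}_2 gates and variables that is false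
on all inputs with at most n ones is true on all inputs with at least n+1 ones,
i.e. it computes THR^{kn+1}_{n+1}. -/
theorem thr_lower_bound_computes (k n d : ℕ) (hk : 2 ≤ k) (hn : 1 ≤ n)
    (g : (Fin (k * n + 1) → Bool) → Bool) (hg : g ∈ Thr k (k * n + 1) d)
    (hlow : ∀ x : Fin (k * n + 1) → Bool, numOnes x ≤ n → g x = false) :
    ∀ x : Fin (k * n + 1) → Bool, n + 1 ≤ numOnes x → g x = true := by
  intro x hx
  by_contra hgx
  have hgx : g x = false := by simpa using hgx
  set S := Finset.univ.filter fun i => x i = false with hS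
  have hcard : n + 1 + S.card ≤ k * n + 1 := by
    have h := Finset.card_filter_add_card_filter_not
      (s := (Finset.univ : Finset (Fin (k * n + 1)))) (fun i => x i = true)
    have e : (Finset.univ.filter fun i => ¬ x i = true) = S := by
      ext i
      simp [hS]
    rw [e, Finset.card_univ, Fintype.card_fin] at h
    simp only [numOnes] at hx
    omega
  obtain ⟨c, hc, hcinj⟩ : ∃ c : Fin (k * n + 1) → ℕ, (∀ i, x i = false → c i < S.card) ∧
      ∀ i j, x i = false → x j = false → c i = c j → i = j := by
    refine ⟨fun i => if h : i ∈ S then (S.equivFin ⟨i, h⟩ : ℕ) else 0, ?_, ?_⟩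
    · intro i hi
      have : i ∈ S := by simp [hS, hi]
      simp [this]
    · intro i j hi hj hij
      have h1 : i ∈ S := by simp [hS, hi]
      have h2 : j ∈ S := by simp [hS, hj]
      simp only [h1, h2, dite_true] at hij
      simpa using S.equivFin.injective (Fin.ext hij)
  let z : Fin k → Fin (k * n + 1) → Bool := fun l i =>
    if l.val = 0 then x i else (!x i && decide (c i / n + 1 = l.val))
  obtain ⟨i, hi⟩ := common_zero k _ d g hg z (by
    intro l
    by_cases hl : l.val = 0
    · have : z l = x := by funext i; simp [z, hl]
      rw [this, hgx]
    · apply hlow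
      have hcl := Finset.card_le_card_of_injOn (s := Finset.univ.filter fun i => z l i = true)
        (t := Finset.Ico ((l.val - 1) * n) ((l.val - 1) * n + n)) c (by
          intro i hi
          simp [z, hl] at hi
          obtain ⟨_, h2⟩ := hi
          have h3 : c i / n = l.val - 1 := by omega
          have h4 := Nat.div_add_mod (c i) n
          have h5 := Nat.mod_lt (c i) (show n > 0 by omega)
          rw [h3, mul_comm] at h4
          simp only [Finset.coe_Ico, Set.mem_Ico]
          omega) (by
          intro i hi j hj hij
          simp [z, hl] at hi hj
          exact hcinj i j hi.1 hj.1 hij)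
      simpa [numOnes] using hcl)
  have hx0 : x i = false := by simpa [z] using hi ⟨0, by omega⟩
  have hlt : c i / n < k - 1 := by
    rw [Nat.div_lt_iff_lt_mul (by omega), Nat.sub_mul]
    have := hc i hx0
    omega
  have := hi ⟨c i / n + 1, by omega⟩
  simp [z, hx0] at this
end

section
/- For every k ≥ 2 there is a constant c such that the following holds for all n ≥ 1 and d ∈ ℕ. Let f : (Fin n → Bool) → Bool with f ∈ Q_k, and let C ∈ Thr(k,n,d) satisfy C ≤ f. Then there exists a k-party tree protocol of depth at most c·(d+1) computing the Q_k-communication game for f. (Paper's Proposition 'Q_k_to_protocols'.) -/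
/-- A k-party number-in-hand tree protocol with inputs from X and outputs in Y. -/
inductive Protocol (X Y : Type) (k : ℕ) : Type
  | leaf (y : Y)
  | node (i : Fin k) (φ : X → Bool) (π₀ π₁ : Protocol X Y k)

/-- Depth of a protocol tree (a leaf has depth 0). -/
def Protocol.depth {X Y : Type} {k : ℕ} : Protocol X Y k → ℕ
  | .leaf _ => 0
  | .node _ _ π₀ π₁ => max π₀.depth π₁.depth + 1

/-- Output of a protocol on an input tuple. -/
def Protocol.out {X Y : Type} {k : ℕ} : Protocol X Y k → (Fin k → X) → Y
  | .leaf y, _ => y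
  | .node i φ π₀ π₁, x => if φ (x i) then π₁.out x else π₀.out x

/-- The protocol π computes the Q_k-communication game for f. -/
def ComputesQGame (k n : ℕ) (f : (Fin n → Bool) → Bool)
    (π : Protocol (Fin n → Bool) (Fin n) k) : Prop :=
  ∀ x : Fin k → Fin n → Bool, (∀ i, f (x i) = false) →
    ∀ i, x i (π.out x) = false

/-- Ask the parties in the list whether `φ` is false; continue with `p` if so, else `q`. -/
def tryP {X Y : Type} {k : ℕ} (φ : X → Bool) (p q : Protocol X Y k) :
    List (Fin k) → Protocol X Y k
  | [] => p
  | i :: l => .node i φ (tryP φ p q l) q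

theorem tryP_depth {X Y : Type} {k : ℕ} (φ : X → Bool) (p q : Protocol X Y k)
    (l : List (Fin k)) : (tryP φ p q l).depth ≤ l.length + max p.depth q.depth := by
  induction l with
  | nil => simp [tryP]
  | cons i l ih => simp only [tryP, Protocol.depth, List.length_cons]; omega

theorem tryP_out {X Y : Type} {k : ℕ} (φ : X → Bool) (p q : Protocol X Y k)
    (l : List (Fin k)) (x : Fin k → X) :
    ((∀ i ∈ l, φ (x i) = false) ∧ (tryP φ p q l).out x = p.out x) ∨
    ((∃ i ∈ l, φ (x i) = true) ∧ (tryP φ p q l).out x = q.out x) := by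
  induction l with
  | nil => left; simp [tryP]
  | cons i l ih =>
    cases h : φ (x i)
    · simpa [tryP, Protocol.out, h] using ih
    · right; simp [tryP, Protocol.out, h]

theorem chain_exists {X Y J : Type} {k : ℕ} (g : J → X → Bool) (p : J → Protocol X Y k)
    (j0 : J) (D : ℕ) (hD : ∀ j, (p j).depth ≤ D) (l : List J) :
    ∃ π : Protocol X Y k, π.depth ≤ l.length * k + D ∧
      ∀ x : Fin k → X, (∃ j ∈ l, ∀ i, g j (x i) = false) →
        ∃ j, (∀ i, g j (x i) = false) ∧ π.out x = (p j).out x := by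
  induction l with
  | nil => exact ⟨p j0, by simpa using hD j0, by simp⟩
  | cons j l ih =>
    obtain ⟨q, hq, hx⟩ := ih
    refine ⟨tryP (g j) (p j) q (List.finRange k), ?_, ?_⟩
    · have h1 := tryP_depth (g j) (p j) q (List.finRange k)
      have h2 := hD j
      simp only [List.length_finRange, List.length_cons, Nat.add_mul, Nat.one_mul] at h1 ⊢
      omega
    · intro x h
      rcases tryP_out (g j) (p j) q (List.finRange k) x with ⟨h1, h2⟩ | ⟨⟨i, -, h1⟩, h2⟩
      · exact ⟨j, fun i => h1 i (List.mem_finRange i), h2⟩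
      · rw [h2]
        apply hx
        obtain ⟨j', hj', h3⟩ := h
        rcases List.mem_cons.1 hj' with rfl | hj'
        · simp [h3 i] at h1
        · exact ⟨j', hj', h3⟩

theorem pigeon {k : ℕ} (v : Fin k → Fin (k + 1) → Bool)
    (h : ∀ i, THRgate k (v i) = false) : ∃ j, ∀ i, v i j = false := by
  by_contra! hc
  choose s hs using hc
  obtain ⟨a, b, hab, he⟩ := Fintype.exists_ne_map_eq_of_card_lt s (by simp)
  have h1 := h (s a)
  replace h1 := of_decide_eq_false h1
  apply h1
  unfold numOnes
  apply Finset.one_lt_card.2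
  refine ⟨a, ?_, b, ?_, hab⟩
  · simpa using hs a
  · simpa [he] using hs b

theorem Thr_protocol (k n d : ℕ) : ∀ C ∈ Thr k n d,
    ∃ π : Protocol (Fin n → Bool) (Fin n) k, π.depth ≤ (k + 1) * k * d ∧
      ∀ x : Fin k → Fin n → Bool, (∀ i, C (x i) = false) → ∀ i, x i (π.out x) = false := by
  induction d with
  | zero =>
    rintro C ⟨j, rfl⟩
    exact ⟨.leaf j, by simp [Protocol.depth], fun x h i => h i⟩
  | succ d ih =>
    rintro C (hC | ⟨g, hg, rfl⟩)
    · obtain ⟨π, h1, h2⟩ := ih C hC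
      exact ⟨π, h1.trans (Nat.mul_le_mul_left _ (Nat.le_succ d)), h2⟩
    · choose p hp1 hp2 using fun j => ih (g j) (hg j)
      obtain ⟨π, h1, h2⟩ := chain_exists g p 0 _ hp1 (List.finRange (k + 1))
      refine ⟨π, ?_, ?_⟩
      · rw [List.length_finRange] at h1
        rw [Nat.mul_succ]
        omega
      · intro x hx
        obtain ⟨j, hj⟩ := pigeon (fun i j => g j (x i)) hx
        obtain ⟨j', h3, h4⟩ := h2 x ⟨j, List.mem_finRange j, hj⟩
        rw [h4]
        exact hp2 j' x h3

/-- circuits of THR^{k+1}_2 gates and variables lower-bounding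
f ∈ Q_k yield protocols for the Q_k-game with constant-factor depth blowup. -/
theorem Qk_to_protocols (k : ℕ) (hk : 2 ≤ k) :
    ∃ c : ℕ, ∀ n d : ℕ, 1 ≤ n → ∀ f : (Fin n → Bool) → Bool, QkMem k n f →
      ∀ C ∈ Thr k n d, circLE C f →
        ∃ π : Protocol (Fin n → Bool) (Fin n) k,
          π.depth ≤ c * (d + 1) ∧ ComputesQGame k n f π := by
  refine ⟨(k + 1) * k, fun n d _ f _ C hC hle => ?_⟩
  obtain ⟨π, h1, h2⟩ := Thr_protocol k n d C hC
  exact ⟨π, h1.trans (Nat.mul_le_mul_left _ (Nat.le_succ d)),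
    fun x hx => h2 x fun i => hle _ (hx i)⟩
end

section
/- For every k ≥ 2 there is a constant c > 0 such that for every n ≥ 1 there exists a k-party tree protocol of depth at most ⌈c · (log₂(n+1) + 1)²⌉ computing the Q_k-communication game for THR^{kn+1}_{n+1}. (This is the binary-search protocol of O(log² n) bits of communication constructed in the proof of the paper's Corollary 'weak version' of Theorem 3.) -/
/-- There is a protocol of depth at most `d` whose output is good on all inputs in `S`. -/
def Solves (N k d : ℕ) (S : Set (Fin k → Fin N → Bool)) : Prop :=
  ∃ π : Protocol (Fin N → Bool) (Fin N) k, π.depth ≤ d ∧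
    ∀ x ∈ S, ∀ i, x i (π.out x) = false

theorem Solves.mono {N k d d' : ℕ} {S S' : Set (Fin k → Fin N → Bool)}
    (h : Solves N k d S) (hd : d ≤ d') (hS : S' ⊆ S) : Solves N k d' S' := by
  obtain ⟨π, h1, h2⟩ := h
  exact ⟨π, h1.trans hd, fun x hx => h2 x (hS hx)⟩

/-- A party announces a number below `2 ^ L` with `L` bits. -/
theorem Solves.query {N k D : ℕ} (i : Fin k) (L : ℕ) :
    ∀ (g : (Fin N → Bool) → ℕ) (S : Set (Fin k → Fin N → Bool)), (∀ y, g y < 2 ^ L) →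
      (∀ v, Solves N k D (S ∩ {x | g (x i) = v})) → Solves N k (L + D) S := by
  induction L with
  | zero =>
    intro g S hg h
    refine (h 0).mono (by omega) ?_
    intro x hx
    refine ⟨hx, ?_⟩
    have := hg (x i)
    simp only [Set.mem_ofPred_eq]
    omega
  | succ L ih =>
    intro g S hg h
    have key : ∀ r, Solves N k (L + D) (S ∩ {x | g (x i) % 2 = r}) := by
      intro r
      refine ih (fun y => g y / 2) _ ?_ ?_
      · intro y
        have := hg y
        rw [pow_succ] at this
        show g y / 2 < 2 ^ L
        omega
      · intro v
        refine (h (2 * v + r)).mono le_rfl ?_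
        rintro x ⟨⟨hx, hr⟩, hv⟩
        refine ⟨hx, ?_⟩
        simp only [Set.mem_ofPred_eq] at *
        omega
    obtain ⟨π₀, h0, h0'⟩ := key 0
    obtain ⟨π₁, h1, h1'⟩ := key 1
    refine ⟨.node i (fun y => decide (g y % 2 = 1)) π₀ π₁, ?_, ?_⟩
    · simp only [Protocol.depth]
      omega
    · intro x hx
      by_cases hb : g (x i) % 2 = 1
      · simpa [Protocol.out, hb] using h1' x ⟨hx, hb⟩
      · simpa [Protocol.out, hb] using h0' x ⟨hx, by simp only [Set.mem_ofPred_eq]; omega⟩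

/-- The first `m` parties announce numbers below `2 ^ L`. -/
theorem Solves.queryAll {N k D L : ℕ} (g : (Fin N → Bool) → ℕ) (hg : ∀ y, g y < 2 ^ L) (m : ℕ) :
    ∀ (S : Set (Fin k → Fin N → Bool)), m ≤ k →
      (∀ v : Fin k → ℕ, Solves N k D (S ∩ {x | ∀ i : Fin k, i.val < m → g (x i) = v i})) →
      Solves N k (m * L + D) S := by
  induction m with
  | zero =>
    intro S _ h
    refine (h 0).mono (by omega) ?_
    intro x hx
    exact ⟨hx, fun i hi => by omega⟩
  | succ m ih =>
    intro S hm h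
    have : Solves N k (L + (m * L + D)) S := by
      refine Solves.query ⟨m, hm⟩ L g S hg ?_
      intro a
      refine ih _ (by omega) ?_
      intro v
      refine (h (Function.update v ⟨m, hm⟩ a)).mono le_rfl ?_
      rintro x ⟨⟨hx, ha⟩, hv⟩
      refine ⟨hx, ?_⟩
      intro i hi
      by_cases him : i = ⟨m, hm⟩
      · subst him
        simpa using ha
      · rw [Function.update_of_ne him]
        refine hv i ?_
        have : i.val ≠ m := fun h => him (Fin.ext h)
        omega
    exact this.mono (by rw [Nat.succ_mul]; omega) subset_rfl

/-- Number of ones with position in `[a, b)`. -/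
def cnt {N : ℕ} (a b : ℕ) (x : Fin N → Bool) : ℕ :=
  (Finset.univ.filter fun i : Fin N => x i = true ∧ a ≤ i.val ∧ i.val < b).card

theorem cnt_le {N : ℕ} (a b : ℕ) (x : Fin N → Bool) : cnt a b x ≤ N := by
  simpa [cnt] using Finset.card_le_univ
    (Finset.univ.filter fun i : Fin N => x i = true ∧ a ≤ i.val ∧ i.val < b)

theorem cnt_add {N : ℕ} (a b c : ℕ) (h1 : a ≤ b) (h2 : b ≤ c) (x : Fin N → Bool) :
    cnt a c x = cnt a b x + cnt b c x := by
  unfold cnt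
  rw [← Finset.card_union_of_disjoint]
  · congr 1
    ext i
    simp only [Finset.mem_filter, Finset.mem_univ, true_and, Finset.mem_union]
    grind
  · rw [Finset.disjoint_left]
    intro i hi hj
    simp only [Finset.mem_filter, Finset.mem_univ, true_and] at hi hj
    omega

theorem Solves.search {N k L : ℕ} (hL : N < 2 ^ L) (t : ℕ) :
    ∀ a b : ℕ, a < b → b ≤ N → b ≤ a + 2 ^ t →
      Solves N k (t * (k * L)) {x | ∑ i, cnt a b (x i) < b - a} := by
  induction t with
  | zero =>
    intro a b hab hbN hb
    refine ⟨.leaf ⟨a, by omega⟩, by simp [Protocol.depth], ?_⟩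
    intro x hx i
    have hs : ∑ i, cnt a b (x i) = 0 := by
      simp only [Set.mem_ofPred_eq] at hx
      omega
    have hi := (Finset.sum_eq_zero_iff.mp hs) i (Finset.mem_univ i)
    simp only [cnt, Finset.card_eq_zero, Finset.filter_eq_empty_iff] at hi
    have := hi (Finset.mem_univ (⟨a, by omega⟩ : Fin N))
    simp only [Protocol.out]
    simpa [hab] using this
  | succ t ih =>
    intro a b hab hbN hb
    rw [pow_succ] at hb
    by_cases h1 : b = a + 1
    · exact (ih a b hab hbN (by have := Nat.one_le_two_pow (n := t); omega)).mono
        (by rw [Nat.succ_mul]; omega) subset_rfl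
    obtain ⟨m, hm⟩ : ∃ m, m = (a + b) / 2 := ⟨_, rfl⟩
    have : Solves N k (k * L + t * (k * L)) {x | ∑ i, cnt a b (x i) < b - a} := by
      refine Solves.queryAll (cnt a m) (fun y => (cnt_le a m y).trans_lt hL) k _ le_rfl ?_
      intro v
      by_cases hv : ∑ i, v i < m - a
      · refine (ih a m (by omega) (by omega) (by omega)).mono le_rfl ?_
        rintro x ⟨hx, hxv⟩
        simp only [Set.mem_ofPred_eq] at *
        rwa [Finset.sum_congr rfl (fun i _ => hxv i i.2)]
      · refine (ih m b (by omega) (by omega) (by omega)).mono le_rfl ?_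
        rintro x ⟨hx, hxv⟩
        simp only [Set.mem_ofPred_eq] at *
        have h2 : ∑ i, cnt a b (x i) = ∑ i, cnt a m (x i) + ∑ i, cnt m b (x i) := by
          rw [← Finset.sum_add_distrib]
          exact Finset.sum_congr rfl (fun i _ => cnt_add a m b (by omega) (by omega) (x i))
        have h3 : ∑ i, cnt a m (x i) = ∑ i, v i :=
          Finset.sum_congr rfl (fun i _ => hxv i i.2)
        omega
    exact this.mono (by rw [Nat.succ_mul]; omega) subset_rfl

/-- for every k ≥ 2 there is a binary-search style k-party protocol
of depth O(log² n) computing the Q_k-communication game for THR^{kn+1}_{n+1}. -/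
theorem Qk_game_thr_protocol (k : ℕ) (hk : 2 ≤ k) :
    ∃ c : ℝ, 0 < c ∧ ∀ n : ℕ, 1 ≤ n →
      ∃ π : Protocol (Fin (k * n + 1) → Bool) (Fin (k * n + 1)) k,
        π.depth ≤ ⌈c * (Real.logb 2 (n + 1) + 1) ^ 2⌉₊ ∧
        ComputesQGame k (k * n + 1) (THR (b := k * n + 1) (n + 1)) π := by
  have hk1 : (1 : ℝ) ≤ k := by exact_mod_cast (by omega : 1 ≤ k)
  have hlk : 0 ≤ Real.logb 2 k := Real.logb_nonneg (by norm_num) hk1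
  refine ⟨k * (Real.logb 2 k + 1) ^ 2, by positivity, ?_⟩
  intro n hn
  obtain ⟨L, hLdef⟩ : ∃ L, L = Nat.log 2 (k * n + 1) + 1 := ⟨_, rfl⟩
  have hL : k * n + 1 < 2 ^ L := by
    rw [hLdef]
    exact Nat.lt_pow_succ_log_self (by norm_num) _
  obtain ⟨π, hd, hπ⟩ := Solves.search (k := k) hL L 0 (k * n + 1) (by omega) le_rfl (by omega)
  refine ⟨π, hd.trans ?_, ?_⟩
  · have hln : 0 ≤ Real.logb 2 ((n : ℝ) + 1) :=
      Real.logb_nonneg (by norm_num) (by linarith [Nat.cast_nonneg (α := ℝ) n])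
    have h1 : (L : ℝ) ≤ (Real.logb 2 k + 1) * (Real.logb 2 (n + 1) + 1) := by
      have h2 : ((Nat.log 2 (k * n + 1) : ℕ) : ℝ) ≤ Real.logb 2 ((k * n + 1 : ℕ) : ℝ) :=
        Real.natLog_le_logb _ _
      have h3 : Real.logb 2 ((k * n + 1 : ℕ) : ℝ) ≤ Real.logb 2 ((k : ℝ) * (n + 1)) := by
        apply Real.logb_le_logb_of_le (by norm_num) (by positivity)
        push_cast
        linarith
      rw [Real.logb_mul (by positivity) (by positivity)] at h3
      rw [hLdef]
      push_cast
      nlinarith [mul_nonneg hlk hln]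
    have h4 : ((L * (k * L) : ℕ) : ℝ) ≤
        k * (Real.logb 2 k + 1) ^ 2 * (Real.logb 2 (n + 1) + 1) ^ 2 := by
      push_cast
      calc (L : ℝ) * (k * L) = k * (L : ℝ) ^ 2 := by ring
        _ ≤ k * ((Real.logb 2 k + 1) * (Real.logb 2 (n + 1) + 1)) ^ 2 := by gcongr
        _ = _ := by ring
    exact_mod_cast h4.trans (Nat.le_ceil _)
  · intro x hx
    apply hπ
    simp only [Set.mem_ofPred_eq]
    have h5 : ∀ i, cnt 0 (k * n + 1) (x i) ≤ n := by
      intro i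
      have h6 := hx i
      simp only [THR, decide_eq_false_iff_not, not_le] at h6
      refine le_trans (Finset.card_le_card ?_) (Nat.lt_succ_iff.mp h6)
      intro j hj
      simp only [Finset.mem_filter, Finset.mem_univ, true_and] at hj ⊢
      exact hj.1
    have h7 : ∑ i, cnt 0 (k * n + 1) (x i) ≤ ∑ _i : Fin k, n :=
      Finset.sum_le_sum fun i _ => h5 i
    simp at h7
    omega
end
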